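/- Suppose p ≥ 3, ∑_{i=1}^p (d_i/d₁)^{1−j} − 2 > 0, and X ∈ ℝ^p, Z ∈ ℝ^n have joint density (∏_{i=1}^p d_i^{-1/2}) σ^{-p-n} f(((x−θ)ᵀD^{-1}(x−θ) + zᵀz)/σ²). If d₁ > d₂ let η_* be the unique positive root of ∑_{i=1}^p (d_i/d₁)^η = 2 and let η_** be any value in (max{0, 1−j}, η_*); if d₁ = d₂ let η_** be any value > max{1−j, 0}. Set c_i = (d₁/d_i)^{j−1+η_**}, u₊ = (2/(n+2))(∑_{i=1}^p (d_i/d₁)^{η_**} − 2) and v₊ = min_{1≤j'<i≤p} [c_i c_{j'} (d₁ d_{j'} − d_i d_p)/(c_i d₁ d_{j'} − c_{j'} d_i d_p)]. Then c₁ ≤ c₂ ≤ … ≤ c_p, and any estimator θ̂_φ with φ differentiable, φ′ ≥ 0, lim_{w→∞} φ(w) ≤ u₊ and 0 ≤ φ(w)/w ≤ v₊ for all w > 0 (and with all risk expectations finite) satisfies: (a) R_j(θ̂_φ, θ, σ²) ≤ R_j(X, θ, σ²) for all θ ∈ ℝ^p, σ² > 0 (minimaxity under L_j), and (b) for every t =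 φ(w)/w, (max_i d_i(1 − t/c_i))/(min_i d_i(1 − t/c_i)) ≤ d₁/d_p (the condition number is not increased). -/

import Mathlib

open MeasureTheory Finset Filter
open scoped ENNReal

/-- Exchange of the `i`-th coordinate with an additional real variable of integration. -/
theorem lintegral_lintegral_update_swap {ι : Type*} [Fintype ι] [DecidableEq ι] (i : ι)
    {Φ : (ι → ℝ) → ℝ → ℝ≥0∞} (hΦ : Measurable (Function.uncurry Φ)) :
    ∫⁻ r, ∫⁻ u, Φ r u = ∫⁻ r, ∫⁻ u, Φ (Function.update r i u) (r i) := by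
  have hL : Measurable fun r => ∫⁻ u, Φ r u := hΦ.lintegral_prod_right'
  have hR : Measurable fun r : ι → ℝ => ∫⁻ u, Φ (Function.update r i u) (r i) := by
    apply Measurable.lintegral_prod_right'
      (f := fun q : (ι → ℝ) × ℝ => Φ (Function.update q.1 i q.2) (q.1 i))
    refine hΦ.comp (f := fun q : (ι → ℝ) × ℝ => (Function.update q.1 i q.2, q.1 i)) ?_
    exact measurable_update'.prodMk (by fun_prop)
  rw [volume_pi, lintegral_eq_lmarginal_univ (0 : ι → ℝ), lintegral_eq_lmarginal_univ (0 : ι → ℝ),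
    lmarginal_erase' _ hL (Finset.mem_univ i), lmarginal_erase' _ hR (Finset.mem_univ i)]
  congr 1
  funext r
  simp only [Function.update_idem, Function.update_self]
  refine lintegral_lintegral_swap (Measurable.aemeasurable ?_)
  exact hΦ.comp (f := fun q : ℝ × ℝ => (Function.update r i q.1, q.2))
    (((measurable_update r).comp measurable_fst).prodMk measurable_snd)

theorem lintegral_abs_mul_comp_sq {a : ℝ} (ha : 0 < a) (ρ v m : ℝ) (f : ℝ → ℝ≥0∞) :
    ∫⁻ u, (if |v| < |u - m| then ENNReal.ofReal |u - m| * f ((u - m) ^ 2 / a + ρ) else 0)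
      = ENNReal.ofReal a * ∫⁻ s in Set.Ioi (v ^ 2 / a + ρ), f s := by
  rw [lintegral_sub_right_eq_self
    (fun u => if |v| < |u| then ENNReal.ofReal |u| * f (u ^ 2 / a + ρ) else 0)]
  have hpos : ∫⁻ u in Set.Ioi |v|, ENNReal.ofReal u * f (u ^ 2 / a + ρ)
      = ENNReal.ofReal (a / 2) * ∫⁻ s in Set.Ioi (v ^ 2 / a + ρ), f s := by
    have himg : (fun u : ℝ => u ^ 2 / a + ρ) '' Set.Ioi |v| = Set.Ioi (v ^ 2 / a + ρ) := by
      ext s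
      simp only [Set.mem_image, Set.mem_Ioi]
      constructor
      · rintro ⟨u, hu, rfl⟩
        have : v ^ 2 < u ^ 2 := sq_lt_sq.mpr (hu.trans_le (le_abs_self u))
        gcongr
      · intro hs
        have h2 : v ^ 2 < a * (s - ρ) := by
          have : v ^ 2 / a < s - ρ := by linarith
          rwa [div_lt_iff₀ ha, mul_comm] at this
        refine ⟨√(a * (s - ρ)), Real.lt_sqrt_of_sq_lt (by simpa using h2), ?_⟩
        rw [Real.sq_sqrt ((sq_nonneg v).trans h2.le)]
        field_simp
        ring
    rw [← himg, lintegral_image_eq_lintegral_deriv_mul_of_monotoneOn (f' := fun u => 2 * u / a)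
      measurableSet_Ioi, ← lintegral_const_mul' _ _ ENNReal.ofReal_ne_top]
    · refine setLIntegral_congr_fun measurableSet_Ioi fun u hu => ?_
      have hu0 : 0 < u := (abs_nonneg v).trans_lt hu
      rw [← mul_assoc, ← ENNReal.ofReal_mul (by positivity)]
      congr 2
      field_simp
    · intro u _
      have := ((hasDerivAt_pow 2 u).div_const a).add_const ρ
      simpa using this.hasDerivWithinAt
    · intro x hx y hy hxy
      have : 0 ≤ x := (abs_nonneg v).trans (le_of_lt hx)
      dsimp only
      gcongr
  have hset : {u : ℝ | |v| < |u|} = Set.Ioi |v| ∪ Set.Iio (-|v|) := by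
    ext u; simp [lt_abs, lt_neg]
  have hind : ∀ u : ℝ, (if |v| < |u| then ENNReal.ofReal |u| * f (u ^ 2 / a + ρ) else 0)
      = {u : ℝ | |v| < |u|}.indicator (fun u => ENNReal.ofReal |u| * f (u ^ 2 / a + ρ)) u := by
    intro u
    simp [Set.indicator]
  simp_rw [hind]
  rw [hset, lintegral_indicator (measurableSet_Ioi.union measurableSet_Iio),
    lintegral_union measurableSet_Iio]
  · have e1 : ∫⁻ u in Set.Ioi |v|, ENNReal.ofReal |u| * f (u ^ 2 / a + ρ)
        = ∫⁻ u in Set.Ioi |v|, ENNReal.ofReal u * f (u ^ 2 / a + ρ) :=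
      setLIntegral_congr_fun measurableSet_Ioi fun u hu => by
        simp only [abs_of_pos ((abs_nonneg v).trans_lt hu)]
    have e2 : ∫⁻ u in Set.Iio (-|v|), ENNReal.ofReal |u| * f (u ^ 2 / a + ρ)
        = ∫⁻ u in Set.Ioi |v|, ENNReal.ofReal |u| * f (u ^ 2 / a + ρ) := by
      have := (Measure.measurePreserving_neg (volume : Measure ℝ)).setLIntegral_comp_preimage_emb
        (MeasurableEquiv.neg ℝ).measurableEmbedding
        (fun u => ENNReal.ofReal |u| * f (u ^ 2 / a + ρ)) (Set.Ioi |v|)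
      simpa using this
    rw [e2, e1, hpos, ← add_mul, ← ENNReal.ofReal_add (by positivity) (by positivity), add_halves]
  · rw [Set.disjoint_left]
    intro u hu hu'
    simp only [Set.mem_Ioi, Set.mem_Iio] at hu hu'
    linarith [abs_nonneg v]

/-- The squared distance `∑ (r_s - m_s)² / a_s` with weights `1 / a_s`. -/
noncomputable def weightedSqDist {ι : Type*} [Fintype ι] (m a r : ι → ℝ) : ℝ :=
  ∑ s, (r s - m s) ^ 2 / a s

/-- The tail integral `∫_t^∞ f` of a nonnegative function `f`. -/
noncomputable def tailMass (f : ℝ → ℝ) (t : ℝ) : ℝ≥0∞ :=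
  ∫⁻ s in Set.Ioi t, ENNReal.ofReal (f s)

theorem measurable_tailMass (f : ℝ → ℝ) : Measurable (tailMass f) := by
  have : Antitone (tailMass f) := fun s t hst =>
    lintegral_mono_set (Set.Ioi_subset_Ioi hst)
  exact this.measurable

section Stein

variable {ι : Type*} [Fintype ι] {m a : ι → ℝ}

theorem measurable_weightedSqDist : Measurable (weightedSqDist m a) := by
  unfold weightedSqDist
  fun_prop

variable [DecidableEq ι]

theorem weightedSqDist_update (r : ι → ℝ) (i : ι) (u : ℝ) :
    weightedSqDist m a (Function.update r i u) =
      (u - m i) ^ 2 / a i + ∑ s ∈ univ.erase i, (r s - m s) ^ 2 / a s := by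
  rw [weightedSqDist, ← Finset.add_sum_erase _ _ (Finset.mem_univ i), Function.update_self]
  congr 1
  refine Finset.sum_congr rfl fun s hs => ?_
  rw [Function.update_of_ne (Finset.ne_of_mem_erase hs)]

theorem lintegral_abs_mul_lintegral_update (ha : ∀ i, 0 < a i) (i : ι) {f : ℝ → ℝ}
    (hf : Measurable f) {G : (ι → ℝ) → ℝ≥0∞} (hG : Measurable G) :
    ∫⁻ r, ∫⁻ u, (if |u - m i| < |r i - m i| then
        ENNReal.ofReal |r i - m i| * G (Function.update r i u) *
          ENNReal.ofReal (f (weightedSqDist m a r)) else 0) =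
      ENNReal.ofReal (a i) * ∫⁻ r, G r * tailMass f (weightedSqDist m a r) := by
  have hQ : Measurable (weightedSqDist m a) := measurable_weightedSqDist
  rw [lintegral_lintegral_update_swap i, ← lintegral_const_mul' _ _ ENNReal.ofReal_ne_top]
  · refine lintegral_congr fun r => ?_
    have h := lintegral_abs_mul_comp_sq (ha i) (∑ s ∈ univ.erase i, (r s - m s) ^ 2 / a s)
      (r i - m i) (m i) (fun s => ENNReal.ofReal (f s))
    have hr : weightedSqDist m a r =
        (r i - m i) ^ 2 / a i + ∑ s ∈ univ.erase i, (r s - m s) ^ 2 / a s := by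
      rw [← weightedSqDist_update, Function.update_eq_self]
    simp only [Function.update_self, Function.update_idem, Function.update_eq_self]
    rw [tailMass, hr, mul_left_comm, ← h, ← lintegral_const_mul]
    · refine lintegral_congr fun u => ?_
      rw [weightedSqDist_update]
      split_ifs
      · ring
      · simp
    · refine Measurable.ite (measurableSet_lt (by fun_prop) (by fun_prop)) ?_ measurable_const
      fun_prop
  · refine Measurable.ite (measurableSet_lt (by fun_prop) (by fun_prop)) ?_ measurable_const
    have : Measurable fun q : (ι → ℝ) × ℝ => Function.update q.1 i q.2 := measurable_update'
    fun_prop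

theorem lintegral_abs_mul_intervalIntegral_update (ha : ∀ i, 0 < a i) (i : ι) {f : ℝ → ℝ}
    (hf : Measurable f) (hf0 : ∀ t, 0 ≤ f t) {G : (ι → ℝ) → ℝ} (hG : Measurable G)
    (hG0 : ∀ r, 0 ≤ G r) {B : ℝ} (hGB : ∀ r, G r ≤ B) :
    ∫⁻ r, ENNReal.ofReal (|r i - m i| *
        (∫ u in (m i - |r i - m i|)..(m i + |r i - m i|), G (Function.update r i u)) *
          f (weightedSqDist m a r)) =
      ENNReal.ofReal (a i) *
        ∫⁻ r, ENNReal.ofReal (G r) * tailMass f (weightedSqDist m a r) := by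
  rw [← lintegral_abs_mul_lintegral_update ha i hf hG.ennreal_ofReal]
  refine lintegral_congr fun r => ?_
  set y := |r i - m i| with hy
  have hy0 : 0 ≤ y := abs_nonneg _
  have hGr : Measurable fun u => G (Function.update r i u) := hG.comp (measurable_update r)
  have hset : {u : ℝ | |u - m i| < y} = Set.Ioo (m i - y) (m i + y) := by
    ext u
    simp only [Set.mem_ofPred_eq, Set.mem_Ioo, abs_lt]
    constructor <;> rintro ⟨h1, h2⟩ <;> constructor <;> linarith
  have hf_int : IntegrableOn (fun u => G (Function.update r i u)) (Set.Ioo (m i - y) (m i + y)) := by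
    refine Measure.integrableOn_of_bounded (M := B) (by simp) hGr.aestronglyMeasurable ?_
    refine Eventually.of_forall fun u => ?_
    rw [Real.norm_of_nonneg (hG0 _)]
    exact hGB _
  calc ENNReal.ofReal (y * (∫ u in (m i - y)..(m i + y), G (Function.update r i u)) *
          f (weightedSqDist m a r))
      = ENNReal.ofReal y * (∫⁻ u in Set.Ioo (m i - y) (m i + y),
          ENNReal.ofReal (G (Function.update r i u))) *
          ENNReal.ofReal (f (weightedSqDist m a r)) := by
        rw [intervalIntegral.integral_of_le (by linarith), integral_Ioc_eq_integral_Ioo,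
          ENNReal.ofReal_mul' (hf0 _), ENNReal.ofReal_mul hy0,
          ofReal_integral_eq_lintegral_ofReal hf_int (Eventually.of_forall fun u => hG0 _)]
    _ = ∫⁻ u in Set.Ioo (m i - y) (m i + y), ENNReal.ofReal y *
          ENNReal.ofReal (G (Function.update r i u)) *
            ENNReal.ofReal (f (weightedSqDist m a r)) := by
        rw [lintegral_mul_const' _ _ ENNReal.ofReal_ne_top,
          lintegral_const_mul' _ _ ENNReal.ofReal_ne_top]
    _ = _ := by
        rw [← lintegral_indicator measurableSet_Ioo, ← hset]
        simp [Set.indicator]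

theorem lintegral_sq_eq_lintegral_tailMass (ha : ∀ i, 0 < a i) (i : ι) {f : ℝ → ℝ}
    (hf : Measurable f) (hf0 : ∀ t, 0 ≤ f t) :
    ∫⁻ r, ENNReal.ofReal (2 * ((r i - m i) ^ 2 * f (weightedSqDist m a r))) =
      ENNReal.ofReal (a i) * ∫⁻ r, tailMass f (weightedSqDist m a r) := by
  have h := lintegral_abs_mul_intervalIntegral_update (m := m) ha i hf hf0
    (G := fun _ => 1) measurable_const (fun _ => zero_le_one) (B := 1) (fun _ => le_rfl)
  simp only [intervalIntegral.integral_const, ENNReal.ofReal_one, one_mul] at h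
  rw [← h]
  refine lintegral_congr fun r => ?_
  congr 1
  rw [← sq_abs, smul_eq_mul]
  ring

theorem measurePreserving_reflect (m : ι → ℝ) (i : ι) :
    MeasurePreserving fun r : ι → ℝ => Function.update r i (2 * m i - r i) := by
  have h := volume_preserving_pi (f := fun (s : ι) (x : ℝ) => if s = i then 2 * m i - x else x)
    (fun s => by
      by_cases hs : s = i
      · simp only [hs, if_true]
        exact Measure.measurePreserving_sub_left volume (2 * m i)
      · simp only [hs, if_false]
        exact MeasurePreserving.id _)
  convert! h using 2 with r
  funext s
  by_cases hs : s = i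
  · subst hs; simp
  · simp [hs]

theorem integral_mul_eq_integral_reflect (i : ι) (f : ℝ → ℝ) (H : (ι → ℝ) → ℝ)
    (hf_int : Integrable fun r => (r i - m i) * H r * f (weightedSqDist m a r)) :
    Integrable (fun r => (r i - m i) * (H r - H (Function.update r i (2 * m i - r i))) *
        f (weightedSqDist m a r)) ∧
      ∫ r, (r i - m i) * (H r - H (Function.update r i (2 * m i - r i))) *
        f (weightedSqDist m a r) = 2 * ∫ r, (r i - m i) * H r * f (weightedSqDist m a r) := by
  have hmp := measurePreserving_reflect m i
  have hemb : MeasurableEmbedding fun r : ι → ℝ => Function.update r i (2 * m i - r i) :=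
    (MeasurableEquiv.ofInvolutive (fun r : ι → ℝ => Function.update r i (2 * m i - r i))
      (fun r => by simp) hmp.measurable).measurableEmbedding
  have hrefl : ∀ r : ι → ℝ, (Function.update r i (2 * m i - r i) i - m i) *
      H (Function.update r i (2 * m i - r i)) *
        f (weightedSqDist m a (Function.update r i (2 * m i - r i))) =
      -((r i - m i) * H (Function.update r i (2 * m i - r i)) * f (weightedSqDist m a r)) := by
    intro r
    have : weightedSqDist m a (Function.update r i (2 * m i - r i)) = weightedSqDist m a r := by
      rw [weightedSqDist_update, ← Function.update_eq_self i r, weightedSqDist_update]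
      simp only [Function.update_eq_self]
      congr 2
      ring
    rw [this, Function.update_self]
    ring
  have hf_int' := (hmp.integrable_comp_emb hemb).mpr hf_int
  have heq := hmp.integral_comp hemb fun r => (r i - m i) * H r * f (weightedSqDist m a r)
  simp only [Function.comp_def, hrefl] at hf_int' heq
  rw [integral_neg] at heq
  have hsplit : (fun r : ι → ℝ => (r i - m i) * (H r - H (Function.update r i (2 * m i - r i))) *
      f (weightedSqDist m a r)) = fun r => (r i - m i) * H r * f (weightedSqDist m a r) +
        -((r i - m i) * H (Function.update r i (2 * m i - r i)) * f (weightedSqDist m a r)) := by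
    funext r; ring
  rw [hsplit]
  refine ⟨hf_int.add hf_int', ?_⟩
  rw [integral_add hf_int hf_int', integral_neg, heq]
  ring

theorem lintegral_tailMass_le_integral (ha : ∀ i, 0 < a i) (i : ι) {f : ℝ → ℝ}
    (hf : Measurable f) (hf0 : ∀ t, 0 ≤ f t) {G H : (ι → ℝ) → ℝ} (hG : Measurable G)
    (hG0 : ∀ r, 0 ≤ G r) {B : ℝ} (hGB : ∀ r, G r ≤ B)
    (hGH : ∀ r, ∀ s t : ℝ, s ≤ t → ∫ u in s..t, G (Function.update r i u) ≤
      H (Function.update r i t) - H (Function.update r i s))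
    (hf_int : Integrable fun r => (r i - m i) * H r * f (weightedSqDist m a r)) :
    0 ≤ 2 * ∫ r, (r i - m i) * H r * f (weightedSqDist m a r) ∧
    ENNReal.ofReal (a i) * ∫⁻ r, ENNReal.ofReal (G r) * tailMass f (weightedSqDist m a r) ≤
      ENNReal.ofReal (2 * ∫ r, (r i - m i) * H r * f (weightedSqDist m a r)) := by
  obtain ⟨hf_int', heq⟩ := integral_mul_eq_integral_reflect i f H hf_int
  have hle : ∀ r, |r i - m i| *
        (∫ u in (m i - |r i - m i|)..(m i + |r i - m i|), G (Function.update r i u)) *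
          f (weightedSqDist m a r) ≤
      (r i - m i) * (H r - H (Function.update r i (2 * m i - r i))) *
        f (weightedSqDist m a r) := by
    intro r
    refine mul_le_mul_of_nonneg_right ?_ (hf0 _)
    refine (mul_le_mul_of_nonneg_left (hGH r _ _ (by linarith [abs_nonneg (r i - m i)]))
      (abs_nonneg _)).trans_eq ?_
    rcases abs_cases (r i - m i) with ⟨h, _⟩ | ⟨h, _⟩
    · rw [h, show m i + (r i - m i) = r i by ring,
        show m i - (r i - m i) = 2 * m i - r i by ring, Function.update_eq_self]
    · rw [h, show m i + -(r i - m i) = 2 * m i - r i by ring,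
        show m i - -(r i - m i) = r i by ring, Function.update_eq_self]
      ring
  have hnonneg : ∀ r, 0 ≤ |r i - m i| *
        (∫ u in (m i - |r i - m i|)..(m i + |r i - m i|), G (Function.update r i u)) *
          f (weightedSqDist m a r) := fun r =>
    mul_nonneg (mul_nonneg (abs_nonneg _) (intervalIntegral.integral_nonneg
      (by linarith [abs_nonneg (r i - m i)]) fun u _ => hG0 _)) (hf0 _)
  refine ⟨heq ▸ integral_nonneg fun r => (hnonneg r).trans (hle r), ?_⟩
  rw [← lintegral_abs_mul_intervalIntegral_update ha i hf hf0 hG hG0 hGB, ← heq,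
    ofReal_integral_eq_lintegral_ofReal hf_int'
      (Eventually.of_forall fun r => (hnonneg r).trans (hle r))]
  exact lintegral_mono fun r => ENNReal.ofReal_le_ofReal (hle r)

end Stein

theorem intervalIntegral_le_sub_of_le_deriv_of_ne {H H' G : ℝ → ℝ} {x₀ : ℝ} (hc : Continuous H)
    (hd : ∀ x ≠ x₀, HasDerivAt H (H' x) x) (hG : LocallyIntegrable G)
    (hle : ∀ x ≠ x₀, G x ≤ H' x) {s t : ℝ} (hst : s ≤ t) :
    ∫ u in s..t, G u ≤ H t - H s := by
  have key : ∀ {s t : ℝ}, s ≤ t → x₀ ∉ Set.Ioo s t → ∫ u in s..t, G u ≤ H t - H s := by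
    intro s t hst hx₀
    have hne : ∀ x ∈ Set.Ioo s t, x ≠ x₀ := fun x hx h => hx₀ (h ▸ hx)
    exact intervalIntegral.integral_le_sub_of_hasDeriv_right_of_le hst hc.continuousOn
      (fun x hx => (hd x (hne x hx)).hasDerivWithinAt)
      (hG.integrableOn_isCompact isCompact_Icc) fun x hx => hle x (hne x hx)
  by_cases hx₀ : x₀ ∈ Set.Ioo s t
  · have hi : ∀ s t : ℝ, IntervalIntegrable G volume s t := fun s t =>
      (hG.integrableOn_isCompact isCompact_uIcc).intervalIntegrable
    rw [← intervalIntegral.integral_add_adjacent_intervals (hi s x₀) (hi x₀ t)]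
    linarith [key hx₀.1.le (fun h => lt_irrefl _ h.2), key hx₀.2.le (fun h => lt_irrefl _ h.1)]
  · exact key hst hx₀

theorem locallyIntegrable_of_abs_le {G : ℝ → ℝ} (hG : Measurable G) {C : ℝ}
    (hC : ∀ u, |G u| ≤ C) : LocallyIntegrable G :=
  (locallyIntegrable_const C).mono hG.aestronglyMeasurable <|
    Eventually.of_forall fun u => (hC u).trans (le_abs_self C)

section Shrinkage

variable {φ : ℝ → ℝ}

theorem abs_mul_div_mul_one_sub_le (hφ : ∀ w > (0 : ℝ), 0 ≤ φ w / w) {A N S : ℝ}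
    (hA : 0 ≤ A) (hAN : A ≤ N) (hS : 0 ≤ S) :
    |φ (N / S) / (N / S) * (1 - 2 * (A / N))| ≤ φ (N / S) / (N / S) := by
  have hg : 0 ≤ φ (N / S) / (N / S) := by
    rcases (div_nonneg (hA.trans hAN) hS).eq_or_lt with h | h
    · simp [← h]
    · exact hφ _ h
  have h1 : 0 ≤ A / N := div_nonneg hA (hA.trans hAN)
  have h2 : A / N ≤ 1 := div_le_one_of_le₀ hAN (hA.trans hAN)
  rw [abs_mul, abs_of_nonneg hg]
  exact mul_le_of_le_one_right hg (abs_le.mpr ⟨by linarith, by linarith⟩)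

theorem continuous_of_abs_le_of_hasDerivAt {H H' : ℝ → ℝ} {C : ℝ} (hC : ∀ u, |H u| ≤ C * |u|)
    (hd : ∀ x ≠ 0, HasDerivAt H (H' x) x) : Continuous H := by
  rw [continuous_iff_continuousAt]
  intro x
  rcases eq_or_ne x 0 with rfl | hx
  · have h0 : H 0 = 0 := by simpa using hC 0
    rw [ContinuousAt, h0]
    refine squeeze_zero_norm hC ?_
    have : Continuous fun u : ℝ => C * |u| := by fun_prop
    simpa using this.tendsto 0
  · exact (hd x hx).continuousAt

theorem intervalIntegral_le_mul_shrinkage_sub (hφm : Measurable φ)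
    (hφd : ∀ w > (0 : ℝ), DifferentiableAt ℝ φ w) (hφ' : ∀ w > (0 : ℝ), 0 ≤ deriv φ w)
    (hφ0 : ∀ w > (0 : ℝ), 0 ≤ φ w / w) (hφ1 : ∀ w > (0 : ℝ), φ w / w ≤ 1)
    {A B S : ℝ} (hA : 0 < A) (hB : 0 ≤ B) (hS : 0 ≤ S) {s t : ℝ} (hst : s ≤ t) :
    ∫ u in s..t, φ ((A * u ^ 2 + B) / S) / ((A * u ^ 2 + B) / S) *
        (1 - 2 * (A * u ^ 2 / (A * u ^ 2 + B))) ≤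
      φ ((A * t ^ 2 + B) / S) / ((A * t ^ 2 + B) / S) * t -
        φ ((A * s ^ 2 + B) / S) / ((A * s ^ 2 + B) / S) * s := by
  rcases hS.eq_or_lt with rfl | hS
  · simp
  have hw : ∀ u : ℝ, u ≠ 0 → 0 < (A * u ^ 2 + B) / S := fun u hu => by positivity
  have hg1 : ∀ u : ℝ, φ ((A * u ^ 2 + B) / S) / ((A * u ^ 2 + B) / S) ≤ 1 := by
    intro u
    have : 0 ≤ (A * u ^ 2 + B) / S := by positivity
    rcases this.eq_or_lt with h | h
    · simp [← h]
    · exact hφ1 _ h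
  have hg0 : ∀ u : ℝ, 0 ≤ φ ((A * u ^ 2 + B) / S) / ((A * u ^ 2 + B) / S) := by
    intro u
    have : 0 ≤ (A * u ^ 2 + B) / S := by positivity
    rcases this.eq_or_lt with h | h
    · simp [← h]
    · exact hφ0 _ h
  have hd : ∀ u : ℝ, u ≠ 0 → HasDerivAt
      (fun u => φ ((A * u ^ 2 + B) / S) / ((A * u ^ 2 + B) / S) * u)
      ((deriv φ ((A * u ^ 2 + B) / S) * (A * (2 * u) / S) * ((A * u ^ 2 + B) / S) -
        φ ((A * u ^ 2 + B) / S) * (A * (2 * u) / S)) / ((A * u ^ 2 + B) / S) ^ 2 * u +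
        φ ((A * u ^ 2 + B) / S) / ((A * u ^ 2 + B) / S) * 1) u := by
    intro u hu
    have h1 : HasDerivAt (fun u : ℝ => (A * u ^ 2 + B) / S) (A * (2 * u) / S) u := by
      simpa using (((hasDerivAt_pow 2 u).const_mul A).add_const B).div_const S
    have h2 := (hφd _ (hw u hu)).hasDerivAt.comp u h1
    exact (h2.div h1 (hw u hu).ne').mul (hasDerivAt_id u)
  refine intervalIntegral_le_sub_of_le_deriv_of_ne (x₀ := 0)
    (H := fun u => φ ((A * u ^ 2 + B) / S) / ((A * u ^ 2 + B) / S) * u)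
    (continuous_of_abs_le_of_hasDerivAt (C := 1) (fun u => ?_) hd) hd
    (locallyIntegrable_of_abs_le (by fun_prop) (C := 1) fun u =>
      (abs_mul_div_mul_one_sub_le hφ0 (by positivity) (by linarith) hS.le).trans (hg1 u)) ?_ hst
  · rw [abs_mul, abs_of_nonneg (hg0 u)]
    exact mul_le_mul_of_nonneg_right (hg1 u) (abs_nonneg u)
  · intro u hu
    have hN : 0 < A * u ^ 2 + B := by positivity
    have hφ'u := hφ' _ (hw u hu)
    set w := (A * u ^ 2 + B) / S with hwdef
    have hw0 : 0 < w := hw u hu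
    have hNw : A * u ^ 2 + B = w * S := by rw [hwdef]; field_simp
    rw [hNw]
    have : (deriv φ w * (A * (2 * u) / S) * w - φ w * (A * (2 * u) / S)) / w ^ 2 * u + φ w / w * 1
        = φ w / w * (1 - 2 * (A * u ^ 2 / (w * S))) + 2 * A * u ^ 2 / (S * w) * deriv φ w := by
      field_simp
      ring
    rw [this]
    have : 0 ≤ 2 * A * u ^ 2 / (S * w) * deriv φ w := by positivity
    linarith

theorem two_mul_shrinkage_le_intervalIntegral (hφm : Measurable φ)
    (hφd : ∀ w > (0 : ℝ), DifferentiableAt ℝ φ w) (hφ' : ∀ w > (0 : ℝ), 0 ≤ deriv φ w)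
    (hφ0 : ∀ w > (0 : ℝ), 0 ≤ φ w / w) (hφ1 : ∀ w > (0 : ℝ), φ w / w ≤ 1)
    {L : ℝ} (hφL : ∀ w > (0 : ℝ), φ w ≤ L)
    {B N : ℝ} (hB : 0 ≤ B) (hN : 0 ≤ N) {y : ℝ} (hy : 0 ≤ y) :
    2 * (φ (N / (y ^ 2 + B)) * (φ (N / (y ^ 2 + B)) / (N / (y ^ 2 + B))) * y) ≤
      ∫ u in (-y)..y, φ (N / (u ^ 2 + B)) * (φ (N / (u ^ 2 + B)) / (N / (u ^ 2 + B))) *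
        (1 + 2 * (u ^ 2 / (u ^ 2 + B))) := by
  rcases hN.eq_or_lt with rfl | hN
  · simp
  have hφnn : ∀ w > (0 : ℝ), 0 ≤ φ w := fun w hw => by
    have := mul_nonneg (hφ0 w hw) hw.le
    rwa [div_mul_cancel₀ _ hw.ne'] at this
  have hL : 0 ≤ L := (hφnn 1 one_pos).trans (hφL 1 one_pos)
  have hh : ∀ u : ℝ, 0 ≤ φ (N / (u ^ 2 + B)) * (φ (N / (u ^ 2 + B)) / (N / (u ^ 2 + B))) ∧
      φ (N / (u ^ 2 + B)) * (φ (N / (u ^ 2 + B)) / (N / (u ^ 2 + B))) ≤ L := by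
    intro u
    have : 0 ≤ N / (u ^ 2 + B) := by positivity
    rcases this.eq_or_lt with h | h
    · simp [← h, hL]
    · exact ⟨mul_nonneg (hφnn _ h) (hφ0 _ h),
        (mul_le_mul (hφL _ h) (hφ1 _ h) (hφ0 _ h) hL).trans_eq (mul_one L)⟩
  set K : ℝ → ℝ := fun u => φ (N / (u ^ 2 + B)) * (φ (N / (u ^ 2 + B)) / (N / (u ^ 2 + B))) *
    (1 + 2 * (u ^ 2 / (u ^ 2 + B))) with hK
  have hKint : LocallyIntegrable K := by
    refine locallyIntegrable_of_abs_le (by fun_prop) (C := L * 3) fun u => ?_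
    have h1 : 0 ≤ u ^ 2 / (u ^ 2 + B) := by positivity
    have h2 : u ^ 2 / (u ^ 2 + B) ≤ 1 := div_le_one_of_le₀ (by linarith) (by positivity)
    rw [hK, abs_of_nonneg (mul_nonneg (hh u).1 (by linarith))]
    exact mul_le_mul (hh u).2 (by linarith) (by linarith) hL
  have hsym : ∫ u in (-y)..0, K u = ∫ u in (0 : ℝ)..y, K u := by
    have := intervalIntegral.integral_comp_neg (a := 0) (b := y) K
    rw [neg_zero] at this
    rw [← this]
    simp [hK]
  have hd : ∀ u : ℝ, u ≠ 0 → HasDerivAt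
      (fun u => φ (N / (u ^ 2 + B)) * (φ (N / (u ^ 2 + B)) / (N / (u ^ 2 + B))) * u)
      ((deriv φ (N / (u ^ 2 + B)) * (N * (-(2 * u) / (u ^ 2 + B) ^ 2)) *
          (φ (N / (u ^ 2 + B)) / (N / (u ^ 2 + B))) + φ (N / (u ^ 2 + B)) *
        ((deriv φ (N / (u ^ 2 + B)) * (N * (-(2 * u) / (u ^ 2 + B) ^ 2)) * (N / (u ^ 2 + B)) -
          φ (N / (u ^ 2 + B)) * (N * (-(2 * u) / (u ^ 2 + B) ^ 2))) / (N / (u ^ 2 + B)) ^ 2)) * u +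
        φ (N / (u ^ 2 + B)) * (φ (N / (u ^ 2 + B)) / (N / (u ^ 2 + B))) * 1) u := by
    intro u hu
    have hS : 0 < u ^ 2 + B := by positivity
    have h0 : HasDerivAt (fun u : ℝ => u ^ 2 + B) (2 * u) u := by
      simpa using (hasDerivAt_pow 2 u).add_const B
    have h1 : HasDerivAt (fun u : ℝ => N / (u ^ 2 + B)) (N * (-(2 * u) / (u ^ 2 + B) ^ 2)) u := by
      simpa [div_eq_mul_inv] using (h0.inv hS.ne').const_mul N
    have hw : 0 < N / (u ^ 2 + B) := by positivity
    have h2 := (hφd _ hw).hasDerivAt.comp u h1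
    exact (h2.mul (h2.div h1 hw.ne')).mul (hasDerivAt_id u)
  have hcont : Continuous
      (fun u => φ (N / (u ^ 2 + B)) * (φ (N / (u ^ 2 + B)) / (N / (u ^ 2 + B))) * u) :=
    continuous_of_abs_le_of_hasDerivAt (C := L) (fun u => by
      rw [abs_mul, abs_of_nonneg (hh u).1]
      exact mul_le_mul_of_nonneg_right (hh u).2 (abs_nonneg u)) hd
  have hle := intervalIntegral.sub_le_integral_of_hasDeriv_right_of_le hy hcont.continuousOn
    (fun u hu => (hd u hu.1.ne').hasDerivWithinAt)
    (hKint.integrableOn_isCompact isCompact_Icc) (fun u hu => by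
      have hu0 : 0 < u := hu.1
      have hS : 0 < u ^ 2 + B := by positivity
      have hw0 : 0 < N / (u ^ 2 + B) := by positivity
      have hφ'u := hφ' _ hw0
      have hφu := hφnn _ hw0
      rw [hK]
      dsimp only
      set w := N / (u ^ 2 + B) with hwdef
      have hNw : N = w * (u ^ 2 + B) := by rw [hwdef]; field_simp
      rw [hNw]
      set S := u ^ 2 + B
      have : (deriv φ w * (w * S * (-(2 * u) / S ^ 2)) * (φ w / w) + φ w *
          ((deriv φ w * (w * S * (-(2 * u) / S ^ 2)) * w - φ w * (w * S * (-(2 * u) / S ^ 2))) /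
            w ^ 2)) * u + φ w * (φ w / w) * 1
          = φ w * (φ w / w) * (1 + 2 * (u ^ 2 / S)) - 4 * (u ^ 2 / S) * (φ w * deriv φ w) := by
        field_simp
        ring
      rw [this]
      have : 0 ≤ 4 * (u ^ 2 / S) * (φ w * deriv φ w) := by positivity
      linarith)
  rw [← intervalIntegral.integral_add_adjacent_intervals (b := 0)
    (hKint.integrableOn_isCompact isCompact_uIcc).intervalIntegrable
    (hKint.integrableOn_isCompact isCompact_uIcc).intervalIntegrable, hsym]
  rw [mul_zero, sub_zero] at hle
  linarith

end Shrinkage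

section SteinReal

variable {ι : Type*} [Fintype ι] {m a : ι → ℝ} {f : ℝ → ℝ}

theorem integrable_mul_toReal_tailMass
    (htail : ∫⁻ r, tailMass f (weightedSqDist m a r) ≠ ∞) {G : (ι → ℝ) → ℝ} (hG : Measurable G)
    {B : ℝ} (hGB : ∀ r, |G r| ≤ B) :
    Integrable fun r => G r * (tailMass f (weightedSqDist m a r)).toReal :=
  (integrable_toReal_of_lintegral_ne_top
    ((measurable_tailMass f).comp measurable_weightedSqDist).aemeasurable htail).bdd_mul
    hG.aestronglyMeasurable (Eventually.of_forall hGB)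

theorem lintegral_ofReal_mul_tailMass
    (htail : ∫⁻ r, tailMass f (weightedSqDist m a r) ≠ ∞) {G : (ι → ℝ) → ℝ} (hG : Measurable G)
    (hG0 : ∀ r, 0 ≤ G r) {B : ℝ} (hGB : ∀ r, G r ≤ B) :
    ∫⁻ r, ENNReal.ofReal (G r) * tailMass f (weightedSqDist m a r) =
      ENNReal.ofReal (∫ r, G r * (tailMass f (weightedSqDist m a r)).toReal) := by
  rw [ofReal_integral_eq_lintegral_ofReal (integrable_mul_toReal_tailMass htail hG
    fun r => (abs_of_nonneg (hG0 r)).trans_le (hGB r))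
    (Eventually.of_forall fun r => mul_nonneg (hG0 r) ENNReal.toReal_nonneg)]
  refine lintegral_congr_ae ?_
  filter_upwards [ae_lt_top ((measurable_tailMass f).comp measurable_weightedSqDist) htail]
    with r hr
  rw [Function.comp_apply] at hr
  rw [ENNReal.ofReal_mul (hG0 r), ENNReal.ofReal_toReal hr.ne]

variable [DecidableEq ι]

theorem lintegral_tailMass_ne_top (ha : ∀ i, 0 < a i) (i : ι) (hf : Measurable f)
    (hf0 : ∀ t, 0 ≤ f t) (hsq : Integrable fun r => (r i - m i) ^ 2 * f (weightedSqDist m a r)) :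
    ∫⁻ r, tailMass f (weightedSqDist m a r) ≠ ∞ := by
  intro h
  have h2 := lintegral_sq_eq_lintegral_tailMass (m := m) ha i hf hf0
  rw [h, ENNReal.mul_top (by simpa using ha i)] at h2
  exact (hsq.const_mul 2).lintegral_lt_top.ne h2

/-- Stein's inequality for a spherically symmetric density: if `G` is dominated by the partial
derivative of `H` in the direction `i`, in integrated form, then `a_i ∫ G F ≤ 2 ∫ (r_i - m_i) H f`
with `F` the tail integral of `f`. -/
theorem mul_integral_tailMass_le (ha : ∀ i, 0 < a i) (i : ι) (hf : Measurable f)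
    (hf0 : ∀ t, 0 ≤ f t) {G H : (ι → ℝ) → ℝ} (hG : Measurable G) {B : ℝ} (hGB : ∀ r, |G r| ≤ B)
    (hGH : ∀ r, ∀ s t : ℝ, s ≤ t → ∫ u in s..t, G (Function.update r i u) ≤
      H (Function.update r i t) - H (Function.update r i s))
    (hsq : Integrable fun r => (r i - m i) ^ 2 * f (weightedSqDist m a r))
    (hf_int : Integrable fun r => (r i - m i) * H r * f (weightedSqDist m a r)) :
    a i * ∫ r, G r * (tailMass f (weightedSqDist m a r)).toReal ≤
      2 * ∫ r, (r i - m i) * H r * f (weightedSqDist m a r) := by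
  have htail := lintegral_tailMass_ne_top ha i hf hf0 hsq
  have hGB' := fun r => abs_le.mp (hGB r)
  have hsq0 : 0 ≤ ∫ r, (r i - m i) ^ 2 * f (weightedSqDist m a r) :=
    integral_nonneg fun r => mul_nonneg (sq_nonneg _) (hf0 _)
  have hsplit : (fun r => (r i - m i) * (H r + B * (r i - m i)) * f (weightedSqDist m a r)) =
      fun r => (r i - m i) * H r * f (weightedSqDist m a r) +
        B * ((r i - m i) ^ 2 * f (weightedSqDist m a r)) := by
    funext r; ring
  obtain ⟨hpos, hmain⟩ := lintegral_tailMass_le_integral (m := m) ha i hf hf0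
    (G := fun r => G r + B) (H := fun r => H r + B * (r i - m i)) (hG.add_const B)
    (fun r => by linarith [(hGB' r).1]) (B := 2 * B) (fun r => by linarith [(hGB' r).2])
    (fun r s t hst => by
      have hi : IntervalIntegrable (fun u => G (Function.update r i u)) volume s t :=
        ((locallyIntegrable_of_abs_le (hG.comp (measurable_update r))
          fun u => hGB _).integrableOn_isCompact isCompact_uIcc).intervalIntegrable
      rw [intervalIntegral.integral_add hi intervalIntegrable_const,
        intervalIntegral.integral_const, smul_eq_mul]
      simp only [Function.update_self]
      linarith [hGH r s t hst])
    (by rw [hsplit]; exact hf_int.add (hsq.const_mul B))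
  rw [lintegral_ofReal_mul_tailMass htail (hG.add_const B) (fun r => by linarith [(hGB' r).1])
    (B := 2 * B) (fun r => by linarith [(hGB' r).2]), ← ENNReal.ofReal_mul (ha i).le, hsplit,
    integral_add hf_int (hsq.const_mul B), integral_const_mul] at hmain
  rw [hsplit, integral_add hf_int (hsq.const_mul B), integral_const_mul] at hpos
  have hsecond := lintegral_sq_eq_lintegral_tailMass (m := m) ha i hf hf0
  have hone := lintegral_ofReal_mul_tailMass htail (G := fun _ => 1) measurable_const
    (fun _ => zero_le_one) (B := 1) (fun _ => le_rfl)
  simp only [ENNReal.ofReal_one, one_mul] at hone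
  rw [hone, ← ofReal_integral_eq_lintegral_ofReal (hsq.const_mul 2)
    (Eventually.of_forall fun r => mul_nonneg zero_le_two (mul_nonneg (sq_nonneg _) (hf0 _))),
    ← ENNReal.ofReal_mul (ha i).le, integral_const_mul,
    ENNReal.ofReal_eq_ofReal_iff (by positivity)
      (mul_nonneg (ha i).le (integral_nonneg fun r => ENNReal.toReal_nonneg))] at hsecond
  have hadd : ∫ r, (G r + B) * (tailMass f (weightedSqDist m a r)).toReal =
      (∫ r, G r * (tailMass f (weightedSqDist m a r)).toReal) +
        B * ∫ r, (tailMass f (weightedSqDist m a r)).toReal := by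
    simp_rw [add_mul]
    rw [integral_add (integrable_mul_toReal_tailMass htail hG hGB)
      (integrable_mul_toReal_tailMass htail measurable_const (B := |B|) fun _ => le_rfl),
      integral_const_mul]
  rw [ENNReal.ofReal_le_ofReal_iff hpos, hadd] at hmain
  linear_combination hmain + B * hsecond

/-- The reverse of Stein's inequality for the vector field `(r_i - m_i) h`. -/
theorem two_mul_integral_sq_mul_le (ha : ∀ i, 0 < a i) (i : ι) (hf : Measurable f)
    (hf0 : ∀ t, 0 ≤ f t) (htail : ∫⁻ r, tailMass f (weightedSqDist m a r) ≠ ∞)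
    {G h : (ι → ℝ) → ℝ} (hG : Measurable G) (hG0 : ∀ r, 0 ≤ G r) {B : ℝ} (hGB : ∀ r, G r ≤ B)
    (hh : Measurable h) (hh0 : ∀ r, 0 ≤ h r)
    (hhG : ∀ r, 2 * (h r * |r i - m i|) ≤
      ∫ u in (m i - |r i - m i|)..(m i + |r i - m i|), G (Function.update r i u)) :
    Integrable (fun r => (r i - m i) ^ 2 * h r * f (weightedSqDist m a r)) ∧
      2 * ∫ r, (r i - m i) ^ 2 * h r * f (weightedSqDist m a r) ≤
        a i * ∫ r, G r * (tailMass f (weightedSqDist m a r)).toReal := by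
  have hnn : ∀ r, 0 ≤ 2 * ((r i - m i) ^ 2 * h r * f (weightedSqDist m a r)) := fun r =>
    mul_nonneg zero_le_two (mul_nonneg (mul_nonneg (sq_nonneg _) (hh0 r)) (hf0 _))
  have hle : ∫⁻ r, ENNReal.ofReal (2 * ((r i - m i) ^ 2 * h r * f (weightedSqDist m a r))) ≤
      ENNReal.ofReal (a i * ∫ r, G r * (tailMass f (weightedSqDist m a r)).toReal) := by
    rw [ENNReal.ofReal_mul (ha i).le, ← lintegral_ofReal_mul_tailMass htail hG hG0 hGB,
      ← lintegral_abs_mul_intervalIntegral_update ha i hf hf0 hG hG0 hGB]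
    refine lintegral_mono fun r => ENNReal.ofReal_le_ofReal ?_
    have := mul_le_mul_of_nonneg_right
      (mul_le_mul_of_nonneg_left (hhG r) (abs_nonneg (r i - m i))) (hf0 (weightedSqDist m a r))
    refine le_trans (le_of_eq ?_) this
    rw [← sq_abs]
    ring
  have hQ : Measurable (weightedSqDist m a) := measurable_weightedSqDist
  have hf_int : Integrable fun r => 2 * ((r i - m i) ^ 2 * h r * f (weightedSqDist m a r)) :=
    ⟨Measurable.aestronglyMeasurable (by fun_prop),
      (hasFiniteIntegral_iff_ofReal (Eventually.of_forall hnn)).mpr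
        (hle.trans_lt ENNReal.ofReal_lt_top)⟩
  refine ⟨?_, ?_⟩
  · simpa using hf_int.const_mul (1 / 2)
  · rw [← ofReal_integral_eq_lintegral_ofReal hf_int (Eventually.of_forall hnn),
      integral_const_mul] at hle
    exact (ENNReal.ofReal_le_ofReal_iff (mul_nonneg (ha i).le (integral_nonneg fun r =>
      mul_nonneg (hG0 r) ENNReal.toReal_nonneg))).mp hle

end SteinReal

section Risk

variable {ι κ : Type*}

/-- The quadratic form `∑ b_i x_i²` in the first block of coordinates. -/
noncomputable def shrinkEnergy [Fintype ι] (b : ι → ℝ) (r : ι ⊕ κ → ℝ) : ℝ :=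
  ∑ i, b i * r (Sum.inl i) ^ 2

/-- The residual sum of squares `∑ z_k²` in the second block of coordinates. -/
noncomputable def residualSq [Fintype κ] (r : ι ⊕ κ → ℝ) : ℝ :=
  ∑ k, r (Sum.inr k) ^ 2

/-- The shrinkage factor `φ(W) / W` with `W = ∑ b_i x_i² / ∑ z_k²`. -/
noncomputable def shrinkFactor [Fintype ι] [Fintype κ] (φ : ℝ → ℝ) (b : ι → ℝ)
    (r : ι ⊕ κ → ℝ) : ℝ :=
  φ (shrinkEnergy b r / residualSq r) / (shrinkEnergy b r / residualSq r)

section Energy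

variable [Fintype ι] {b : ι → ℝ}

theorem shrinkEnergy_nonneg (hb : ∀ i, 0 < b i) (r : ι ⊕ κ → ℝ) : 0 ≤ shrinkEnergy b r :=
  Finset.sum_nonneg fun i _ => mul_nonneg (hb i).le (sq_nonneg _)

theorem mul_sq_le_shrinkEnergy (hb : ∀ i, 0 < b i) (r : ι ⊕ κ → ℝ) (i : ι) :
    b i * r (Sum.inl i) ^ 2 ≤ shrinkEnergy b r :=
  Finset.single_le_sum (f := fun i => b i * r (Sum.inl i) ^ 2)
    (fun i _ => mul_nonneg (hb i).le (sq_nonneg _)) (Finset.mem_univ i)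

theorem measurable_shrinkEnergy (b : ι → ℝ) :
    Measurable (shrinkEnergy b : (ι ⊕ κ → ℝ) → ℝ) := by
  unfold shrinkEnergy
  fun_prop

variable [DecidableEq ι] [DecidableEq κ]

theorem shrinkEnergy_update_inl (b : ι → ℝ) (r : ι ⊕ κ → ℝ) (i : ι) (u : ℝ) :
    shrinkEnergy b (Function.update r (Sum.inl i) u) =
      b i * u ^ 2 + ∑ s ∈ univ.erase i, b s * r (Sum.inl s) ^ 2 := by
  rw [shrinkEnergy, ← Finset.add_sum_erase _ _ (Finset.mem_univ i), Function.update_self]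
  congr 1
  refine Finset.sum_congr rfl fun s hs => ?_
  rw [Function.update_of_ne (by simpa using Finset.ne_of_mem_erase hs)]

theorem shrinkEnergy_update_inr (b : ι → ℝ) (r : ι ⊕ κ → ℝ) (k : κ) (u : ℝ) :
    shrinkEnergy b (Function.update r (Sum.inr k) u) = shrinkEnergy b r := by
  simp [shrinkEnergy]

end Energy

section Residual

variable [Fintype κ]

theorem residualSq_nonneg (r : ι ⊕ κ → ℝ) : 0 ≤ residualSq r :=
  Finset.sum_nonneg fun _ _ => sq_nonneg _

theorem measurable_residualSq : Measurable (residualSq : (ι ⊕ κ → ℝ) → ℝ) := by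
  unfold residualSq
  fun_prop

variable [DecidableEq ι] [DecidableEq κ]

theorem residualSq_update_inl (r : ι ⊕ κ → ℝ) (i : ι) (u : ℝ) :
    residualSq (Function.update r (Sum.inl i) u) = residualSq r := by
  simp [residualSq]

theorem residualSq_update_inr (r : ι ⊕ κ → ℝ) (k : κ) (u : ℝ) :
    residualSq (Function.update r (Sum.inr k) u) =
      u ^ 2 + ∑ s ∈ univ.erase k, r (Sum.inr s) ^ 2 := by
  rw [residualSq, ← Finset.add_sum_erase _ _ (Finset.mem_univ k), Function.update_self]
  congr 1
  refine Finset.sum_congr rfl fun s hs => ?_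
  rw [Function.update_of_ne (by simpa using Finset.ne_of_mem_erase hs)]

end Residual

variable [Fintype ι] [Fintype κ]

section Factor

variable {φ : ℝ → ℝ} {b : ι → ℝ}

theorem shrinkFactor_nonneg (hb : ∀ i, 0 < b i) (hφ0 : ∀ w > (0 : ℝ), 0 ≤ φ w / w)
    (r : ι ⊕ κ → ℝ) : 0 ≤ shrinkFactor φ b r := by
  rcases (div_nonneg (shrinkEnergy_nonneg hb r) (residualSq_nonneg r)).eq_or_lt with h | h
  · simp [shrinkFactor, ← h]
  · exact hφ0 _ h

theorem shrinkFactor_le_one (hb : ∀ i, 0 < b i) (hφ1 : ∀ w > (0 : ℝ), φ w / w ≤ 1)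
    (r : ι ⊕ κ → ℝ) : shrinkFactor φ b r ≤ 1 := by
  rcases (div_nonneg (shrinkEnergy_nonneg hb r) (residualSq_nonneg r)).eq_or_lt with h | h
  · simp [shrinkFactor, ← h]
  · exact hφ1 _ h

theorem measurable_shrinkFactor (hφm : Measurable φ) :
    Measurable (shrinkFactor φ b : (ι ⊕ κ → ℝ) → ℝ) := by
  have h1 : Measurable (shrinkEnergy b : (ι ⊕ κ → ℝ) → ℝ) := measurable_shrinkEnergy b
  have h2 : Measurable (residualSq : (ι ⊕ κ → ℝ) → ℝ) := measurable_residualSq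
  unfold shrinkFactor
  fun_prop

/-- `φ(W) ⬝ φ(W) / W` lies in `[0, L]`, also where `W` is not defined. -/
theorem mul_shrinkFactor_mem_Icc (hb : ∀ i, 0 < b i) (hφ0 : ∀ w > (0 : ℝ), 0 ≤ φ w / w)
    (hφ1 : ∀ w > (0 : ℝ), φ w / w ≤ 1) {L : ℝ} (hφL : ∀ w > (0 : ℝ), φ w ≤ L) (hL : 0 ≤ L)
    (r : ι ⊕ κ → ℝ) :
    φ (shrinkEnergy b r / residualSq r) * shrinkFactor φ b r ∈ Set.Icc 0 L := by
  rcases (div_nonneg (shrinkEnergy_nonneg hb r) (residualSq_nonneg r)).eq_or_lt with h | h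
  · simp [shrinkFactor, ← h, hL]
  · have hφnn : 0 ≤ φ (shrinkEnergy b r / residualSq r) := by
      have := mul_nonneg (hφ0 _ h) h.le
      rwa [div_mul_cancel₀ _ h.ne'] at this
    exact ⟨mul_nonneg hφnn (hφ0 _ h),
      (mul_le_mul (hφL _ h) (hφ1 _ h) (hφ0 _ h) hL).trans_eq (mul_one L)⟩

theorem sq_shrinkFactor_mul_shrinkEnergy (r : ι ⊕ κ → ℝ) (hb : ∀ i, 0 < b i) :
    shrinkFactor φ b r ^ 2 * shrinkEnergy b r =
      residualSq r * (φ (shrinkEnergy b r / residualSq r) * shrinkFactor φ b r) := by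
  rcases (residualSq_nonneg r).eq_or_lt with h | hS
  · simp [shrinkFactor, ← h]
  rcases (shrinkEnergy_nonneg hb r).eq_or_lt with h | hN
  · simp [shrinkFactor, ← h]
  unfold shrinkFactor
  field_simp

theorem sum_mul_one_add (r : ι ⊕ κ → ℝ) :
    ∑ k : κ, φ (shrinkEnergy b r / residualSq r) * shrinkFactor φ b r *
        (1 + 2 * (r (Sum.inr k) ^ 2 / residualSq r)) =
      (Fintype.card κ + 2) * (φ (shrinkEnergy b r / residualSq r) * shrinkFactor φ b r) := by
  rw [← Finset.mul_sum, Finset.sum_add_distrib, ← Finset.mul_sum, ← Finset.sum_div]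
  change _ * (_ + 2 * (residualSq r / residualSq r)) = _
  rcases (residualSq_nonneg r).eq_or_lt with h | hS
  · simp [shrinkFactor, ← h]
  · rw [div_self hS.ne']
    simp only [Finset.sum_const, Finset.card_univ, nsmul_eq_mul, mul_one]
    ring

theorem shrinkFactor_mul_le_sum {ρ : ι → ℝ} (hρ1 : ∀ i, ρ i ≤ 1)
    (hb : ∀ i, 0 < b i) (hφ0 : ∀ w > (0 : ℝ), 0 ≤ φ w / w) (r : ι ⊕ κ → ℝ) :
    shrinkFactor φ b r * ((∑ i, ρ i) - 2) ≤
      ∑ i, ρ i * (shrinkFactor φ b r *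
        (1 - 2 * (b i * r (Sum.inl i) ^ 2 / shrinkEnergy b r))) := by
  have hN := shrinkEnergy_nonneg hb r
  have h1 : ∑ i, ρ i * (b i * r (Sum.inl i) ^ 2 / shrinkEnergy b r) ≤ 1 := by
    calc ∑ i, ρ i * (b i * r (Sum.inl i) ^ 2 / shrinkEnergy b r)
        ≤ ∑ i, b i * r (Sum.inl i) ^ 2 / shrinkEnergy b r :=
          Finset.sum_le_sum fun i _ => mul_le_of_le_one_left
            (div_nonneg (mul_nonneg (hb i).le (sq_nonneg _)) hN) (hρ1 i)
      _ = shrinkEnergy b r / shrinkEnergy b r := by rw [← Finset.sum_div]; rfl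
      _ ≤ 1 := div_self_le_one _
  have h2 : ∑ i, ρ i * (shrinkFactor φ b r *
        (1 - 2 * (b i * r (Sum.inl i) ^ 2 / shrinkEnergy b r))) =
      shrinkFactor φ b r * ((∑ i, ρ i) -
        2 * ∑ i, ρ i * (b i * r (Sum.inl i) ^ 2 / shrinkEnergy b r)) := by
    rw [Finset.mul_sum univ _ (2 : ℝ), ← Finset.sum_sub_distrib, Finset.mul_sum]
    exact Finset.sum_congr rfl fun i _ => by ring
  rw [h2]
  exact mul_le_mul_of_nonneg_left (by linarith) (shrinkFactor_nonneg hb hφ0 r)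

end Factor

variable [DecidableEq ι] [DecidableEq κ]

/-- The shrinkage estimator dominates the identity, up to the normalisation of the density. -/
theorem integral_loss_shrink_le {d c l ρ θ : ι → ℝ} {τ q L : ℝ}
    (hd : ∀ i, 0 < d i) (hc : ∀ i, 1 ≤ c i) (hτ : 0 < τ) (hq : 0 ≤ q)
    (hl : ∀ i, 0 ≤ l i)
    (hρ1 : ∀ i, ρ i ≤ 1) (hlρ : ∀ i, l i * d i / c i = q * ρ i)
    {φ f : ℝ → ℝ} (hφm : Measurable φ)
    (hφd : ∀ w > (0 : ℝ), DifferentiableAt ℝ φ w) (hφ' : ∀ w > (0 : ℝ), 0 ≤ deriv φ w)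
    (hφ0 : ∀ w > (0 : ℝ), 0 ≤ φ w / w) (hφ1 : ∀ w > (0 : ℝ), φ w / w ≤ 1)
    (hφL : ∀ w > (0 : ℝ), φ w ≤ L) (hL : (Fintype.card κ + 2) * L ≤ 2 * ((∑ i, ρ i) - 2))
    (hf : Measurable f) (hf0 : ∀ t, 0 ≤ f t) [Nonempty ι]
    {b : ι → ℝ} (hb : ∀ i, b i = 1 / (c i * d i))
    {m a : ι ⊕ κ → ℝ} (hm : m = Sum.elim θ 0) (ha : a = Sum.elim (fun i => d i * τ) fun _ => τ)
    (hf_int : Integrable fun r => f (weightedSqDist m a r))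
    (hsq : ∀ i, Integrable fun r => (r (Sum.inl i) - θ i) ^ 2 * f (weightedSqDist m a r)) :
    ∫ r, (∑ i, l i * ((1 - shrinkFactor φ b r / c i) * r (Sum.inl i) - θ i) ^ 2) *
        f (weightedSqDist m a r) ≤
      ∫ r, (∑ i, l i * (r (Sum.inl i) - θ i) ^ 2) * f (weightedSqDist m a r) := by
  have hc0 : ∀ i, 0 < c i := fun i => one_pos.trans_le (hc i)
  have hb0 : ∀ i, 0 < b i := fun i => by
    have := hd i; have := hc0 i; rw [hb]; positivity
  have hL0 : 0 ≤ L := by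
    have h := hφ0 1 one_pos
    rw [div_one] at h
    exact h.trans (hφL 1 one_pos)
  have ha0 : ∀ s, 0 < a s := by
    rw [ha]
    rintro (i | k)
    · exact mul_pos (hd i) hτ
    · exact hτ
  have hmi : ∀ i, m (Sum.inl i) = θ i := fun i => by rw [hm]; rfl
  have hmk : ∀ k, m (Sum.inr k) = 0 := fun k => by rw [hm]; rfl
  have hai : ∀ i, a (Sum.inl i) = d i * τ := fun i => by rw [ha]; rfl
  have hak : ∀ k, a (Sum.inr k) = τ := fun k => by rw [ha]; rfl
  have hQm : Measurable (weightedSqDist m a) := measurable_weightedSqDist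
  have hgm : Measurable (shrinkFactor φ b : (ι ⊕ κ → ℝ) → ℝ) := measurable_shrinkFactor hφm
  have hNm : Measurable (shrinkEnergy b : (ι ⊕ κ → ℝ) → ℝ) := measurable_shrinkEnergy b
  have hSm : Measurable (residualSq : (ι ⊕ κ → ℝ) → ℝ) := measurable_residualSq
  have hg0 := shrinkFactor_nonneg (κ := κ) hb0 hφ0
  have hg1 := shrinkFactor_le_one (κ := κ) hb0 hφ1
  have hh := mul_shrinkFactor_mem_Icc (κ := κ) hb0 hφ0 hφ1 hφL hL0
  have htail : ∫⁻ r, tailMass f (weightedSqDist m a r) ≠ ∞ := by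
    obtain ⟨i⟩ := ‹Nonempty ι›
    exact lintegral_tailMass_ne_top ha0 (Sum.inl i) hf hf0 (by simpa only [hmi] using hsq i)
  have hcross_int : ∀ i, Integrable fun r => (r (Sum.inl i) - θ i) *
      (shrinkFactor φ b r * r (Sum.inl i)) * f (weightedSqDist m a r) := by
    intro i
    refine (((hsq i).const_mul 2).add (hf_int.const_mul (θ i ^ 2))).mono'
      (Measurable.aestronglyMeasurable (by fun_prop)) (Eventually.of_forall fun r => ?_)
    rw [Real.norm_eq_abs, abs_mul, abs_of_nonneg (hf0 _), Pi.add_apply, ← mul_assoc (2 : ℝ),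
      ← add_mul]
    refine mul_le_mul_of_nonneg_right ?_ (hf0 _)
    rw [mul_left_comm, abs_mul, abs_of_nonneg (hg0 r)]
    refine (mul_le_of_le_one_left (abs_nonneg _) (hg1 r)).trans (abs_le.mpr ⟨?_, ?_⟩) <;>
      nlinarith [sq_nonneg (r (Sum.inl i) - θ i + θ i), sq_nonneg (r (Sum.inl i) - 2 * θ i),
        sq_nonneg (r (Sum.inl i) - θ i), sq_nonneg (θ i), sq_nonneg (r (Sum.inl i))]
  have hquad_int : ∀ i, Integrable fun r => (shrinkFactor φ b r * r (Sum.inl i)) ^ 2 *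
      f (weightedSqDist m a r) := by
    intro i
    refine (((hsq i).const_mul 2).add (hf_int.const_mul (2 * θ i ^ 2))).mono'
      (Measurable.aestronglyMeasurable (by fun_prop)) (Eventually.of_forall fun r => ?_)
    rw [Real.norm_eq_abs, abs_mul, abs_of_nonneg (hf0 _), Pi.add_apply, ← mul_assoc (2 : ℝ),
      ← add_mul]
    refine mul_le_mul_of_nonneg_right ?_ (hf0 _)
    rw [abs_of_nonneg (sq_nonneg _), mul_pow]
    refine (mul_le_of_le_one_left (sq_nonneg _) (pow_le_one₀ (hg0 r) (hg1 r))).trans ?_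
    nlinarith [sq_nonneg (r (Sum.inl i) - 2 * θ i)]
  have hcross : ∀ i, d i * τ * ∫ r, shrinkFactor φ b r *
        (1 - 2 * (b i * r (Sum.inl i) ^ 2 / shrinkEnergy b r)) *
          (tailMass f (weightedSqDist m a r)).toReal ≤
      2 * ∫ r, (r (Sum.inl i) - θ i) * (shrinkFactor φ b r * r (Sum.inl i)) *
        f (weightedSqDist m a r) := by
    intro i
    have := mul_integral_tailMass_le (m := m) ha0 (Sum.inl i) hf hf0
      (G := fun r => shrinkFactor φ b r *
        (1 - 2 * (b i * r (Sum.inl i) ^ 2 / shrinkEnergy b r)))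
      (H := fun r => shrinkFactor φ b r * r (Sum.inl i)) (by fun_prop) (B := 1)
      (fun r => (abs_mul_div_mul_one_sub_le hφ0 (mul_nonneg (hb0 i).le (sq_nonneg _))
        (mul_sq_le_shrinkEnergy hb0 r i) (residualSq_nonneg r)).trans (hg1 r))
      (fun r s t hst => by
        simp only [shrinkFactor, shrinkEnergy_update_inl, residualSq_update_inl,
          Function.update_self]
        exact intervalIntegral_le_mul_shrinkage_sub hφm hφd hφ' hφ0 hφ1 (hb0 i)
          (Finset.sum_nonneg fun s _ => mul_nonneg (hb0 s).le (sq_nonneg _))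
          (residualSq_nonneg r) hst)
      (by simpa only [hmi] using hsq i) (by simpa only [hmi] using hcross_int i)
    simpa only [hmi, hai] using this
  have hK : ∀ k : κ, ∀ r : ι ⊕ κ → ℝ, φ (shrinkEnergy b r / residualSq r) * shrinkFactor φ b r *
      (1 + 2 * (r (Sum.inr k) ^ 2 / residualSq r)) ∈ Set.Icc 0 (L * 3) := by
    intro k r
    have h1 : 0 ≤ r (Sum.inr k) ^ 2 / residualSq r :=
      div_nonneg (sq_nonneg _) (residualSq_nonneg r)
    have h2 : r (Sum.inr k) ^ 2 / residualSq r ≤ 1 :=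
      div_le_one_of_le₀ (Finset.single_le_sum (f := fun k => r (Sum.inr k) ^ 2)
        (fun _ _ => sq_nonneg _) (Finset.mem_univ k)) (residualSq_nonneg r)
    exact ⟨mul_nonneg (hh r).1 (by linarith),
      mul_le_mul (hh r).2 (by linarith) (by linarith) hL0⟩
  have hres : ∀ k : κ, Integrable (fun r => r (Sum.inr k) ^ 2 *
        (φ (shrinkEnergy b r / residualSq r) * shrinkFactor φ b r) *
          f (weightedSqDist m a r)) ∧
      2 * ∫ r, r (Sum.inr k) ^ 2 *
        (φ (shrinkEnergy b r / residualSq r) * shrinkFactor φ b r) * f (weightedSqDist m a r) ≤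
      τ * ∫ r, φ (shrinkEnergy b r / residualSq r) * shrinkFactor φ b r *
        (1 + 2 * (r (Sum.inr k) ^ 2 / residualSq r)) *
          (tailMass f (weightedSqDist m a r)).toReal := by
    intro k
    have := two_mul_integral_sq_mul_le (m := m) ha0 (Sum.inr k) hf hf0 htail
      (G := fun r => φ (shrinkEnergy b r / residualSq r) * shrinkFactor φ b r *
        (1 + 2 * (r (Sum.inr k) ^ 2 / residualSq r)))
      (h := fun r => φ (shrinkEnergy b r / residualSq r) * shrinkFactor φ b r)
      (by fun_prop) (fun r => (hK k r).1) (fun r => (hK k r).2) (by fun_prop)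
      (fun r => (hh r).1) (fun r => by
        have hr : residualSq r = |r (Sum.inr k)| ^ 2 + ∑ s ∈ univ.erase k, r (Sum.inr s) ^ 2 := by
          rw [sq_abs, ← residualSq_update_inr, Function.update_eq_self]
        simp only [shrinkFactor, shrinkEnergy_update_inr, residualSq_update_inr,
          Function.update_self, hmk, sub_zero, zero_sub, zero_add]
        rw [hr]
        exact two_mul_shrinkage_le_intervalIntegral hφm hφd hφ' hφ0 hφ1 hφL
          (Finset.sum_nonneg fun s _ => sq_nonneg _) (shrinkEnergy_nonneg hb0 r) (abs_nonneg _))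
    simpa only [hmk, hak, sub_zero] using this
  have hG_int : ∀ i, Integrable fun r => shrinkFactor φ b r *
      (1 - 2 * (b i * r (Sum.inl i) ^ 2 / shrinkEnergy b r)) *
        (tailMass f (weightedSqDist m a r)).toReal := fun i =>
    integrable_mul_toReal_tailMass htail
      (G := fun r => shrinkFactor φ b r *
        (1 - 2 * (b i * r (Sum.inl i) ^ 2 / shrinkEnergy b r))) (by fun_prop) (B := 1)
      (fun r => (abs_mul_div_mul_one_sub_le hφ0 (mul_nonneg (hb0 i).le (sq_nonneg _))
        (mul_sq_le_shrinkEnergy hb0 r i) (residualSq_nonneg r)).trans (hg1 r))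
  have hK_int : ∀ k : κ, Integrable fun r => φ (shrinkEnergy b r / residualSq r) *
      shrinkFactor φ b r * (1 + 2 * (r (Sum.inr k) ^ 2 / residualSq r)) *
        (tailMass f (weightedSqDist m a r)).toReal := fun k =>
    integrable_mul_toReal_tailMass htail
      (G := fun r => φ (shrinkEnergy b r / residualSq r) * shrinkFactor φ b r *
        (1 + 2 * (r (Sum.inr k) ^ 2 / residualSq r))) (by fun_prop) (B := L * 3)
      fun r => (abs_of_nonneg (hK k r).1).trans_le (hK k r).2
  -- the quadratic part of the loss difference
  have hquad : 2 * ∑ i, l i / c i ^ 2 * ∫ r, (shrinkFactor φ b r * r (Sum.inl i)) ^ 2 *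
        f (weightedSqDist m a r) ≤
      q * τ * ∫ r, (∑ k : κ, φ (shrinkEnergy b r / residualSq r) * shrinkFactor φ b r *
        (1 + 2 * (r (Sum.inr k) ^ 2 / residualSq r))) *
          (tailMass f (weightedSqDist m a r)).toReal := by
    have h1 : ∑ i, l i / c i ^ 2 * ∫ r, (shrinkFactor φ b r * r (Sum.inl i)) ^ 2 *
        f (weightedSqDist m a r) ≤ q * ∑ k : κ, ∫ r, r (Sum.inr k) ^ 2 *
        (φ (shrinkEnergy b r / residualSq r) * shrinkFactor φ b r) *
          f (weightedSqDist m a r) := by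
      simp_rw [← integral_const_mul]
      rw [← integral_finsetSum _ fun i _ => (hquad_int i).const_mul _,
        ← integral_finsetSum _ fun k _ => (hres k).1, ← integral_const_mul]
      refine integral_mono (integrable_finsetSum _ fun i _ => (hquad_int i).const_mul _)
        ((integrable_finsetSum _ fun k _ => (hres k).1).const_mul q) fun r => ?_
      simp only [← Finset.sum_mul, ← mul_assoc]
      refine mul_le_mul_of_nonneg_right ?_ (hf0 _)
      have h2 : ∀ i, l i / c i ^ 2 * (shrinkFactor φ b r * r (Sum.inl i)) ^ 2 ≤
          q * (shrinkFactor φ b r ^ 2 * (b i * r (Sum.inl i) ^ 2)) := by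
        intro i
        have h3 : l i / c i ^ 2 = q * ρ i * b i := by
          have := (hc0 i).ne'
          have := (hd i).ne'
          rw [← hlρ, hb]
          field_simp
        have h4 : 0 ≤ q * (shrinkFactor φ b r ^ 2 * (b i * r (Sum.inl i) ^ 2)) :=
          mul_nonneg hq (mul_nonneg (sq_nonneg _) (mul_nonneg (hb0 i).le (sq_nonneg _)))
        rw [h3]
        refine le_trans (le_of_eq ?_) (mul_le_of_le_one_left h4 (hρ1 i))
        ring
      refine (Finset.sum_le_sum fun i _ => h2 i).trans_eq ?_
      rw [← Finset.mul_sum, ← Finset.mul_sum]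
      change q * (shrinkFactor φ b r ^ 2 * shrinkEnergy b r) = q * residualSq r * _ * _
      rw [sq_shrinkFactor_mul_shrinkEnergy r hb0]
      ring
    have h5 : 2 * ∑ k : κ, ∫ r, r (Sum.inr k) ^ 2 *
        (φ (shrinkEnergy b r / residualSq r) * shrinkFactor φ b r) *
          f (weightedSqDist m a r) ≤
        τ * ∫ r, (∑ k : κ, φ (shrinkEnergy b r / residualSq r) * shrinkFactor φ b r *
        (1 + 2 * (r (Sum.inr k) ^ 2 / residualSq r))) *
          (tailMass f (weightedSqDist m a r)).toReal := by
      simp_rw [Finset.sum_mul]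
      rw [integral_finsetSum _ fun k _ => hK_int k, Finset.mul_sum, Finset.mul_sum]
      exact Finset.sum_le_sum fun k _ => (hres k).2
    nlinarith [mul_le_mul_of_nonneg_left h5 hq]
  -- the cross term of the loss difference
  have hlin : q * τ * ∫ r, (∑ i, ρ i * (shrinkFactor φ b r *
        (1 - 2 * (b i * r (Sum.inl i) ^ 2 / shrinkEnergy b r)))) *
          (tailMass f (weightedSqDist m a r)).toReal ≤
      2 * ∑ i, l i / c i * ∫ r, (r (Sum.inl i) - θ i) * (shrinkFactor φ b r * r (Sum.inl i)) *
        f (weightedSqDist m a r) := by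
    simp_rw [Finset.sum_mul, mul_assoc (ρ _)]
    rw [integral_finsetSum _ fun i _ => (hG_int i).const_mul (ρ i), Finset.mul_sum,
      Finset.mul_sum]
    refine Finset.sum_le_sum fun i _ => ?_
    rw [integral_const_mul]
    have h := mul_le_mul_of_nonneg_left (hcross i) (div_nonneg (hl i) (hc0 i).le)
    have h3 : l i / c i * d i = q * ρ i := by rw [← hlρ]; ring
    linear_combination h - τ * h3 * ∫ r, shrinkFactor φ b r *
        (1 - 2 * (b i * r (Sum.inl i) ^ 2 / shrinkEnergy b r)) *
          (tailMass f (weightedSqDist m a r)).toReal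
  have hcomp : ∫ r, (∑ k : κ, φ (shrinkEnergy b r / residualSq r) * shrinkFactor φ b r *
        (1 + 2 * (r (Sum.inr k) ^ 2 / residualSq r))) *
          (tailMass f (weightedSqDist m a r)).toReal ≤
      2 * ∫ r, (∑ i, ρ i * (shrinkFactor φ b r *
        (1 - 2 * (b i * r (Sum.inl i) ^ 2 / shrinkEnergy b r)))) *
          (tailMass f (weightedSqDist m a r)).toReal := by
    rw [← integral_const_mul]
    refine integral_mono (by
        simp_rw [Finset.sum_mul]
        exact integrable_finsetSum _ fun k _ => hK_int k) (by
        simp_rw [Finset.sum_mul, mul_assoc (ρ _)]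
        exact (integrable_finsetSum _ fun i _ => (hG_int i).const_mul (ρ i)).const_mul 2)
      fun r => ?_
    dsimp only
    rw [← mul_assoc]
    refine mul_le_mul_of_nonneg_right ?_ ENNReal.toReal_nonneg
    rw [sum_mul_one_add]
    refine le_trans ?_ (mul_le_mul_of_nonneg_left
      (shrinkFactor_mul_le_sum hρ1 hb0 hφ0 r) zero_le_two)
    rcases (div_nonneg (shrinkEnergy_nonneg hb0 r) (residualSq_nonneg r)).eq_or_lt with h | h
    · simp [shrinkFactor, ← h]
    · have h1 : (Fintype.card κ + 2 : ℝ) * φ (shrinkEnergy b r / residualSq r) ≤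
          2 * ((∑ i, ρ i) - 2) :=
        (mul_le_mul_of_nonneg_left (hφL _ h) (by positivity)).trans hL
      nlinarith [mul_le_mul_of_nonneg_left h1 (hg0 r)]
  have hexpand : (fun r : ι ⊕ κ → ℝ =>
      (∑ i, l i * ((1 - shrinkFactor φ b r / c i) * r (Sum.inl i) - θ i) ^ 2) *
        f (weightedSqDist m a r)) = fun r =>
      (∑ i, l i * (r (Sum.inl i) - θ i) ^ 2) * f (weightedSqDist m a r) +
      ((∑ i, l i / c i ^ 2 * ((shrinkFactor φ b r * r (Sum.inl i)) ^ 2 *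
        f (weightedSqDist m a r))) -
      2 * ∑ i, l i / c i * ((r (Sum.inl i) - θ i) * (shrinkFactor φ b r * r (Sum.inl i)) *
        f (weightedSqDist m a r))) := by
    funext r
    rw [Finset.sum_mul, Finset.sum_mul, Finset.mul_sum, ← Finset.sum_sub_distrib,
      ← Finset.sum_add_distrib]
    refine Finset.sum_congr rfl fun i _ => ?_
    have := (hc0 i).ne'
    field_simp
    ring
  have hls_int : Integrable fun r : ι ⊕ κ → ℝ =>
      (∑ i, l i * (r (Sum.inl i) - θ i) ^ 2) * f (weightedSqDist m a r) := by
    simp_rw [Finset.sum_mul, mul_assoc (l _)]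
    exact integrable_finsetSum _ fun i _ => (hsq i).const_mul (l i)
  have hq_int := integrable_finsetSum univ fun i _ => (hquad_int i).const_mul (l i / c i ^ 2)
  have hc_int := integrable_finsetSum univ fun i _ => (hcross_int i).const_mul (l i / c i)
  rw [hexpand, integral_add hls_int (hq_int.sub' (hc_int.const_mul 2)),
    integral_sub hq_int (hc_int.const_mul 2), integral_const_mul,
    integral_finsetSum _ fun i _ => (hquad_int i).const_mul (l i / c i ^ 2),
    integral_finsetSum _ fun i _ => (hcross_int i).const_mul (l i / c i)]
  simp_rw [integral_const_mul]
  nlinarith [mul_le_mul_of_nonneg_left hcomp (mul_nonneg hq hτ.le)]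

end Risk

section Product

variable {ι κ : Type*} [Fintype ι] [Fintype κ]

theorem exists_measurable_eqOn_Ioi_zero {φ : ℝ → ℝ}
    (hφ : ∀ w > (0 : ℝ), DifferentiableAt ℝ φ w) :
    ∃ ψ : ℝ → ℝ, Measurable ψ ∧ ∀ w > (0 : ℝ),
      ψ w = φ w ∧ DifferentiableAt ℝ ψ w ∧ deriv ψ w = deriv φ w := by
  refine ⟨(Set.Ioi (0 : ℝ)).indicator φ, ?_, fun w hw => ?_⟩
  · have hc : ContinuousOn φ (Set.Ioi 0) := fun w hw => (hφ w hw).continuousAt.continuousWithinAt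
    rw [← Set.piecewise_eq_indicator]
    exact hc.measurable_piecewise continuousOn_const measurableSet_Ioi
  · have he : (Set.Ioi (0 : ℝ)).indicator φ =ᶠ[nhds w] φ := by
      filter_upwards [Ioi_mem_nhds hw] with x hx using Set.indicator_of_mem hx φ
    exact ⟨he.eq_of_nhds, he.differentiableAt_iff.mpr (hφ w hw), he.deriv_eq⟩

/-- Domination of the identity on the product of the two coordinate blocks, where `φ` need only be
differentiable on the positive half line. -/
theorem integral_prod_loss_shrink_le [Nonempty ι] {d c l ρ θ : ι → ℝ} {τ q L : ℝ}
    (hd : ∀ i, 0 < d i) (hc : ∀ i, 1 ≤ c i) (hτ : 0 < τ) (hq : 0 ≤ q)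
    (hl : ∀ i, 0 ≤ l i)
    (hρ1 : ∀ i, ρ i ≤ 1) (hlρ : ∀ i, l i * d i / c i = q * ρ i)
    {φ f : ℝ → ℝ}
    (hφd : ∀ w > (0 : ℝ), DifferentiableAt ℝ φ w) (hφ' : ∀ w > (0 : ℝ), 0 ≤ deriv φ w)
    (hφ0 : ∀ w > (0 : ℝ), 0 ≤ φ w / w) (hφ1 : ∀ w > (0 : ℝ), φ w / w ≤ 1)
    (hφL : ∀ w > (0 : ℝ), φ w ≤ L) (hL : (Fintype.card κ + 2) * L ≤ 2 * ((∑ i, ρ i) - 2))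
    (hf : Measurable f) (hf0 : ∀ t, 0 ≤ f t)
    (hf_int : Integrable fun x : (ι → ℝ) × (κ → ℝ) =>
      f (((∑ i, (x.1 i - θ i) ^ 2 / d i) + ∑ k, x.2 k ^ 2) / τ))
    (hsq : ∀ i, Integrable fun x : (ι → ℝ) × (κ → ℝ) =>
      (x.1 i - θ i) ^ 2 * f (((∑ i, (x.1 i - θ i) ^ 2 / d i) + ∑ k, x.2 k ^ 2) / τ)) :
    ∫ x : (ι → ℝ) × (κ → ℝ), (∑ i, l i * ((1 -
          φ ((∑ i', x.1 i' ^ 2 / (c i' * d i')) / ∑ k, x.2 k ^ 2) /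
            ((∑ i', x.1 i' ^ 2 / (c i' * d i')) / ∑ k, x.2 k ^ 2) / c i) * x.1 i - θ i) ^ 2) *
        f (((∑ i, (x.1 i - θ i) ^ 2 / d i) + ∑ k, x.2 k ^ 2) / τ) ≤
      ∫ x : (ι → ℝ) × (κ → ℝ), (∑ i, l i * (x.1 i - θ i) ^ 2) *
        f (((∑ i, (x.1 i - θ i) ^ 2 / d i) + ∑ k, x.2 k ^ 2) / τ) := by
  classical
  have hmp := volume_measurePreserving_sumPiEquivProdPi fun _ : ι ⊕ κ => ℝ
  have hemb := (MeasurableEquiv.sumPiEquivProdPi fun _ : ι ⊕ κ => ℝ).measurableEmbedding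
  obtain ⟨ψ, hψm, hψ⟩ := exists_measurable_eqOn_Ioi_zero hφd
  have hψφ : ∀ w > (0 : ℝ), ψ w = φ w := fun w hw => (hψ w hw).1
  have hc0 : ∀ i, 0 < c i := fun i => one_pos.trans_le (hc i)
  have hQ : ∀ r : ι ⊕ κ → ℝ, ((∑ i, (r (Sum.inl i) - θ i) ^ 2 / d i) +
      ∑ k, r (Sum.inr k) ^ 2) / τ =
      weightedSqDist (Sum.elim θ 0) (Sum.elim (fun i => d i * τ) fun _ => τ) r := by
    intro r
    simp only [weightedSqDist, Fintype.sum_sum_type, Sum.elim_inl, Sum.elim_inr, Pi.zero_apply,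
      sub_zero, add_div, Finset.sum_div, div_div]
  have hfac : ∀ r : ι ⊕ κ → ℝ,
      φ ((∑ i, r (Sum.inl i) ^ 2 / (c i * d i)) / ∑ k, r (Sum.inr k) ^ 2) /
        ((∑ i, r (Sum.inl i) ^ 2 / (c i * d i)) / ∑ k, r (Sum.inr k) ^ 2) =
      shrinkFactor ψ (fun i => 1 / (c i * d i)) r := by
    intro r
    have hE : ∑ i, r (Sum.inl i) ^ 2 / (c i * d i) =
        shrinkEnergy (fun i => 1 / (c i * d i)) r :=
      Finset.sum_congr rfl fun i _ => by ring
    have hb : ∀ i, 0 < 1 / (c i * d i) := fun i => one_div_pos.mpr (mul_pos (hc0 i) (hd i))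
    rw [hE, shrinkFactor]
    change φ (_ / residualSq r) / (_ / residualSq r) = _
    rcases (div_nonneg (shrinkEnergy_nonneg hb r) (residualSq_nonneg r)).eq_or_lt with h | h
    · rw [← h, div_zero, div_zero]
    · rw [hψφ _ h]
  rw [← hmp.integral_comp hemb, ← hmp.integral_comp hemb]
  rw [← hmp.integrable_comp_emb hemb] at hf_int
  simp only [← hmp.integrable_comp_emb hemb] at hsq
  simp only [Function.comp_def, MeasurableEquiv.coe_sumPiEquivProdPi, Equiv.sumPiEquivProdPi_apply,
    hQ, hfac] at hf_int hsq ⊢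
  exact integral_loss_shrink_le hd hc hτ hq hl hρ1 hlρ hψm (fun w hw => (hψ w hw).2.1)
    (fun w hw => (hψ w hw).2.2 ▸ hφ' w hw) (fun w hw => hψφ w hw ▸ hφ0 w hw)
    (fun w hw => hψφ w hw ▸ hφ1 w hw) (fun w hw => hψφ w hw ▸ hφL w hw) hL hf hf0
    (fun _ => rfl) rfl rfl hf_int hsq

end Product

theorem mul_one_sub_div_mul_le {d₀ dₘ di dk ci ck t : ℝ} (hm : 0 < dₘ) (hi : 0 < di)
    (hi₀ : di ≤ d₀) (hk : dₘ ≤ dk) (hck : 0 < ck) (hc : ck ≤ ci)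
    (ht : t ≤ ci * ck * (d₀ * dk - di * dₘ) / (ci * d₀ * dk - ck * di * dₘ)) :
    di * (1 - t / ci) * dₘ ≤ d₀ * (dk * (1 - t / ck)) := by
  have hci : 0 < ci := hck.trans_le hc
  have h₀ : 0 < d₀ := hi.trans_le hi₀
  have hle : di * dₘ ≤ d₀ * dk := mul_le_mul hi₀ hk hm.le h₀.le
  have hden : 0 ≤ ci * d₀ * dk - ck * di * dₘ := by
    have := mul_le_mul hc hle (by positivity) hci.le
    linarith
  have key : t * (ci * d₀ * dk - ck * di * dₘ) ≤ ci * ck * (d₀ * dk - di * dₘ) := by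
    rcases hden.eq_or_lt with h | h
    · rw [← h, mul_zero]
      exact mul_nonneg (by positivity) (sub_nonneg.mpr hle)
    · exact (le_div_iff₀ h).mp ht
  have h1 : d₀ * (dk * (1 - t / ck)) - di * (1 - t / ci) * dₘ =
      (ci * ck * (d₀ * dk - di * dₘ) - t * (ci * d₀ * dk - ck * di * dₘ)) / (ci * ck) := by
    field_simp
    ring
  have h2 := div_nonneg (sub_nonneg.mpr key) (mul_pos hci hck).le
  linarith

theorem sup_div_inf_le {ι : Type*} {s : Finset ι} (hs : s.Nonempty) {g : ι → ℝ} {x y : ℝ}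
    (hx : 0 ≤ x) (hy : 0 < y) (hg : ∀ i ∈ s, 0 ≤ g i)
    (h : ∀ i ∈ s, ∀ k ∈ s, g i * y ≤ x * g k) : s.sup' hs g / s.inf' hs g ≤ x / y := by
  obtain ⟨i, hi, hi'⟩ := s.exists_mem_eq_sup' hs g
  obtain ⟨k, hk, hk'⟩ := s.exists_mem_eq_inf' hs g
  rw [hi', hk']
  rcases (hg k hk).eq_or_lt with h0 | h0
  · rw [← h0, div_zero]
    positivity
  · exact (div_le_div_iff₀ h0 hy).mpr (h i hi k hk)

theorem le_of_deriv_nonneg_of_tendsto {φ : ℝ → ℝ} {L : ℝ}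
    (hφ : ∀ w > (0 : ℝ), DifferentiableAt ℝ φ w) (hφ' : ∀ w > (0 : ℝ), 0 ≤ deriv φ w)
    (hL : Tendsto φ atTop (nhds L)) {w : ℝ} (hw : 0 < w) : φ w ≤ L := by
  have hmono : MonotoneOn φ (Set.Ioi 0) := by
    refine monotoneOn_of_deriv_nonneg (convex_Ioi 0)
      (fun x hx => (hφ x hx).continuousAt.continuousWithinAt) ?_ ?_ <;> rw [interior_Ioi]
    · exact fun x hx => (hφ x hx).differentiableWithinAt
    · exact hφ'
  refine ge_of_tendsto hL ?_
  filter_upwards [eventually_ge_atTop w] with x hx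
  exact hmono hw (hw.trans_le hx) hx

/-- Theorem 4.1: suppose `p ≥ 3` and `∑ (d_i/d₁)^{1−j} > 2`. With `η_**` chosen in
`(max{0,1−j}, η_*)` when `d₁ > d₂` (where `η_*` is the positive root of
`∑ (d_i/d₁)^η = 2`), or any value `> max{1−j,0}` when `d₁ = d₂`, set
`c_i = (d₁/d_i)^{j−1+η_**}`, `u₊ = (2/(n+2))(∑ (d_i/d₁)^{η_**} − 2)` and
`v₊ = min_{j'<i} c_i c_{j'}(d₁d_{j'} − d_i d_p)/(c_i d₁ d_{j'} − c_{j'} d_i d_p)`.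
Then `c₁ ≤ … ≤ c_p`, and any `θ̂_φ` with `φ` differentiable nondecreasing,
`0 ≤ φ(w)/w ≤ v₊` and `lim_{w→∞} φ(w) ≤ u₊` is minimax under `L_j` and does not
increase the condition number. -/
theorem stmt_14
    (p n : ℕ) (hp : 3 ≤ p) (hn : 0 < n) (j : ℕ)
    (d c : Fin p → ℝ)
    (hd_pos : ∀ i, 0 < d i)
    (hd_mono : ∀ i k : Fin p, i ≤ k → d k ≤ d i)
    (hsum : 2 < ∑ i, (d i / d ⟨0, by omega⟩) ^ ((1 : ℝ) - j))
    (η : ℝ)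
    (hη : (d ⟨1, by omega⟩ < d ⟨0, by omega⟩ ∧
        ∃ ηs : ℝ, 0 < ηs ∧ (∑ i, (d i / d ⟨0, by omega⟩) ^ ηs) = 2 ∧
          max 0 (1 - (j : ℝ)) < η ∧ η < ηs) ∨
      (d ⟨1, by omega⟩ = d ⟨0, by omega⟩ ∧ max (1 - (j : ℝ)) 0 < η))
    (hc : ∀ i, c i = (d ⟨0, by omega⟩ / d i) ^ ((j : ℝ) - 1 + η))
    (f : ℝ → ℝ) (hf_nonneg : ∀ t, 0 ≤ f t) (hf_meas : Measurable f)
    (φ : ℝ → ℝ)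
    (hφ_diff : ∀ w > (0:ℝ), DifferentiableAt ℝ φ w)
    (hφ_incr : ∀ w > (0:ℝ), 0 ≤ deriv φ w)
    -- `0 ≤ φ(w)/w ≤ v₊` for all `w > 0`
    (hφ_ratio_nonneg : ∀ w > (0:ℝ), 0 ≤ φ w / w)
    (hφ_ratio_le : ∀ w > (0:ℝ), ∀ i k : Fin p, k < i →
      φ w / w ≤ c i * c k * (d ⟨0, by omega⟩ * d k - d i * d ⟨p - 1, by omega⟩) /
        (c i * d ⟨0, by omega⟩ * d k - c k * d i * d ⟨p - 1, by omega⟩))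
    -- `lim_{w→∞} φ(w) ≤ u₊`
    (L : ℝ) (hφ_lim : Tendsto φ atTop (nhds L))
    (hL : L ≤ 2 / ((n : ℝ) + 2) * ((∑ i, (d i / d ⟨0, by omega⟩) ^ η) - 2))
    (θ : Fin p → ℝ) (σ : ℝ) (hσ : 0 < σ)
    (dens : ((Fin p → ℝ) × (Fin n → ℝ)) → ℝ)
    (hdens : dens = fun q => (∏ i, (d i) ^ (-(1:ℝ)/2)) * σ ^ (-(p : ℝ) - n) *
      f (((∑ i, (q.1 i - θ i) ^ 2 / d i) + ∑ k, (q.2 k) ^ 2) / σ ^ 2))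
    (hnorm : ∫ q, dens q = 1)
    (est : ((Fin p → ℝ) × (Fin n → ℝ)) → Fin p → ℝ)
    (hest : est = fun q i =>
      (1 - φ ((∑ i', (q.1 i') ^ 2 / (c i' * d i')) / (∑ k, (q.2 k) ^ 2)) /
          ((∑ i', (q.1 i') ^ 2 / (c i' * d i')) / (∑ k, (q.2 k) ^ 2)) / c i) * q.1 i)
    (h_int_est : Integrable (fun q => (∑ i, (est q i - θ i) ^ 2 / d i ^ j) / σ ^ 2 * dens q))
    (h_int_ls : Integrable (fun q => (∑ i, (q.1 i - θ i) ^ 2 / d i ^ j) / σ ^ 2 * dens q)) :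
    -- `c₁ ≤ … ≤ c_p`
    Monotone c ∧
    -- (a) minimaxity: the risk of `θ̂_φ` is no larger than that of `X`
    (∫ q, (∑ i, (est q i - θ i) ^ 2 / d i ^ j) / σ ^ 2 * dens q ≤
      ∫ q, (∑ i, (q.1 i - θ i) ^ 2 / d i ^ j) / σ ^ 2 * dens q) ∧
    -- (b) the condition number is not increased, for every shrinkage factor `t = φ(w)/w`
    (∀ w > (0:ℝ),
      (univ.sup' (univ_nonempty_iff.mpr ⟨⟨0, by omega⟩⟩)
          (fun i => d i * (1 - φ w / w / c i))) /
        (univ.inf' (univ_nonempty_iff.mpr ⟨⟨0, by omega⟩⟩)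
          (fun i => d i * (1 - φ w / w / c i)))
        ≤ d ⟨0, by omega⟩ / d ⟨p - 1, by omega⟩) := by
  have hd0 := hd_pos ⟨0, by omega⟩
  have hdm := hd_pos ⟨p - 1, by omega⟩
  have hd_le : ∀ i, d i ≤ d ⟨0, by omega⟩ := fun i => hd_mono _ _ (Nat.zero_le _)
  have hd_ge : ∀ i, d ⟨p - 1, by omega⟩ ≤ d i := fun i => hd_mono _ _ (Nat.le_sub_one_of_lt i.2)
  have hη0 : 0 < η ∧ 1 - (j : ℝ) < η := by
    rcases hη with ⟨-, -, -, -, h, -⟩ | ⟨-, h⟩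
    · exact max_lt_iff.mp h
    · exact (max_lt_iff.mp h).symm
  have hexp : 0 ≤ (j : ℝ) - 1 + η := by linarith [hη0.2]
  have hc1 : ∀ i, 1 ≤ c i := fun i => by
    rw [hc]
    exact Real.one_le_rpow ((one_le_div (hd_pos i)).mpr (hd_le i)) hexp
  have hc_pos : ∀ i, 0 < c i := fun i => one_pos.trans_le (hc1 i)
  have hc0 : c ⟨0, by omega⟩ = 1 := by rw [hc, div_self hd0.ne', Real.one_rpow]
  have hc_mono : Monotone c := fun i k hik => by
    rw [hc, hc]
    exact Real.rpow_le_rpow (div_pos hd0 (hd_pos i)).le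
      (div_le_div_of_nonneg_left hd0.le (hd_pos k) (hd_mono i k hik)) hexp
  have ht1 : ∀ w > (0 : ℝ), φ w / w ≤ 1 := fun w hw => by
    refine (hφ_ratio_le w hw ⟨p - 1, by omega⟩ ⟨0, by omega⟩ (Fin.mk_lt_mk.mpr (by omega))).trans ?_
    have h1 := hc1 ⟨p - 1, by omega⟩
    have h2 : d ⟨p - 1, by omega⟩ * d ⟨p - 1, by omega⟩ ≤ d ⟨0, by omega⟩ * d ⟨0, by omega⟩ :=
      mul_le_mul (hd_le _) (hd_le _) hdm.le hd0.le
    rw [hc0]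
    refine div_le_one_of_le₀ ?_ ?_
    · nlinarith [mul_pos hdm hdm]
    · nlinarith [mul_pos hd0 hd0]
  refine ⟨hc_mono, ?_, fun w hw => ?_⟩
  · have hK : 0 < (∏ i, (d i) ^ (-(1:ℝ)/2)) * σ ^ (-(p : ℝ) - n) :=
      mul_pos (Finset.prod_pos fun i _ => Real.rpow_pos_of_pos (hd_pos i) _)
        (Real.rpow_pos_of_pos hσ _)
    set K := (∏ i, (d i) ^ (-(1:ℝ)/2)) * σ ^ (-(p : ℝ) - n)
    have hdens_int : Integrable dens := .of_integral_ne_zero (by rw [hnorm]; exact one_ne_zero)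
    subst hdens hest
    have hf_int : Integrable fun x : (Fin p → ℝ) × (Fin n → ℝ) =>
        f (((∑ i, (x.1 i - θ i) ^ 2 / d i) + ∑ k, x.2 k ^ 2) / σ ^ 2) := by
      refine (hdens_int.const_mul K⁻¹).congr (Eventually.of_forall fun x => ?_)
      exact inv_mul_cancel_left₀ hK.ne' _
    have hsq : ∀ i, Integrable fun x : (Fin p → ℝ) × (Fin n → ℝ) => (x.1 i - θ i) ^ 2 *
        f (((∑ i, (x.1 i - θ i) ^ 2 / d i) + ∑ k, x.2 k ^ 2) / σ ^ 2) := by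
      intro i
      refine (h_int_ls.const_mul (d i ^ j * σ ^ 2 / K)).mono'
        (Measurable.aestronglyMeasurable (by fun_prop)) (Eventually.of_forall fun x => ?_)
      have hle : (x.1 i - θ i) ^ 2 / d i ^ j ≤ ∑ i, (x.1 i - θ i) ^ 2 / d i ^ j :=
        Finset.single_le_sum (f := fun i => (x.1 i - θ i) ^ 2 / d i ^ j)
          (fun i _ => div_nonneg (sq_nonneg _) (pow_pos (hd_pos i) j).le) (Finset.mem_univ i)
      have hdj := pow_pos (hd_pos i) j
      rw [Real.norm_of_nonneg (mul_nonneg (sq_nonneg _) (hf_nonneg _))]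
      rw [div_le_iff₀' hdj] at hle
      refine (mul_le_mul_of_nonneg_right hle (hf_nonneg _)).trans_eq ?_
      field_simp
    have hpull : ∀ g : (Fin p → ℝ) × (Fin n → ℝ) → Fin p → ℝ,
        ∫ x, (∑ i, (g x i - θ i) ^ 2 / d i ^ j) / σ ^ 2 *
          (K * f (((∑ i, (x.1 i - θ i) ^ 2 / d i) + ∑ k, x.2 k ^ 2) / σ ^ 2)) =
        K / σ ^ 2 * ∫ x, (∑ i, 1 / d i ^ j * (g x i - θ i) ^ 2) *
          f (((∑ i, (x.1 i - θ i) ^ 2 / d i) + ∑ k, x.2 k ^ 2) / σ ^ 2) := by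
      intro g
      rw [← integral_const_mul]
      congr 1
      funext x
      simp_rw [one_div_mul_eq_div]
      ring
    rw [hpull, hpull fun x => x.1]
    refine mul_le_mul_of_nonneg_left ?_ (by positivity)
    have : Nonempty (Fin p) := ⟨⟨0, by omega⟩⟩
    refine integral_prod_loss_shrink_le (q := d ⟨0, by omega⟩ ^ (1 - (j : ℝ)))
      (ρ := fun i => (d i / d ⟨0, by omega⟩) ^ η) hd_pos hc1 (pow_pos hσ 2)
      (Real.rpow_nonneg hd0.le _) (fun i => one_div_nonneg.mpr (pow_pos (hd_pos i) j).le)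
      (fun i => Real.rpow_le_one (div_pos (hd_pos i) hd0).le ((div_le_one hd0).mpr (hd_le i))
        hη0.1.le) (fun i => ?_) hφ_diff hφ_incr hφ_ratio_nonneg ht1
      (fun w hw => le_of_deriv_nonneg_of_tendsto hφ_diff hφ_incr hφ_lim hw) ?_
      hf_meas hf_nonneg hf_int hsq
    · have hdi := hd_pos i
      rw [hc, Real.div_rpow hd0.le hdi.le, Real.div_rpow hdi.le hd0.le, Real.rpow_add hd0,
        Real.rpow_add hdi, Real.rpow_sub hd0, Real.rpow_sub hdi, Real.rpow_sub hd0,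
        Real.rpow_one, Real.rpow_one, Real.rpow_natCast, Real.rpow_natCast]
      have h1 := Real.rpow_pos_of_pos hd0 η
      have h2 := Real.rpow_pos_of_pos hdi η
      field_simp
    · have h := mul_le_mul_of_nonneg_left hL (by positivity : (0 : ℝ) ≤ n + 2)
      rw [Fintype.card_fin]
      refine h.trans_eq ?_
      field_simp
  · have hnn : ∀ i, 0 ≤ 1 - φ w / w / c i := fun i =>
      sub_nonneg.mpr (div_le_one_of_le₀ ((ht1 w hw).trans (hc1 i)) (hc_pos i).le)
    refine sup_div_inf_le _ hd0.le hdm (fun i _ => mul_nonneg (hd_pos i).le (hnn i))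
      fun i _ k _ => ?_
    rcases lt_or_ge k i with hki | hik
    · exact mul_one_sub_div_mul_le hdm (hd_pos i) (hd_le i) (hd_ge k) (hc_pos k)
        (hc_mono hki.le) (hφ_ratio_le w hw i k hki)
    · have h1 : 1 - φ w / w / c i ≤ 1 - φ w / w / c k :=
        sub_le_sub_left (div_le_div_of_nonneg_left (hφ_ratio_nonneg w hw) (hc_pos i)
          (hc_mono hik)) 1
      have h2 := mul_le_mul (hd_le i) (hd_ge k) hdm.le hd0.le
      have h3 := mul_le_mul h2 h1 (hnn i) (mul_pos hd0 (hd_pos k)).le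
      linarith
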